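/- Let n ≥ 3 be an integer, N = 2n/(n−2), α ∈ (0,1) and β ∈ (1, n/2). Let τ: ℝⁿ → ℝ be a radial function of class C¹ with |τ(x)| ≤ C(1+|x|)^{−β} and |∂τ(x)| ≤ C(1+|x|)^{−β−1}. Then there exist a radial, positive, nondecreasing (in r = |x|) function φ of class C³ with |φ(x) − 1| ≤ C'(1+|x|)^{2−2β}, |∂φ(x)| ≤ C'(1+|x|)^{1−2β}, |∂²φ(x)| ≤ C'(1+|x|)^{−2β}, and a C² vector field W: ℝⁿ → ℝⁿ, such that (φ, τ, W) solves the vacuum conformal constraint equations on ℝⁿ. Consequently there exists an asymptotically flat solution (g, k) of the vacuum constraint equations on ℝⁿ with g = φ^{N−2} δ_Euc, tr_g k = τ, |g_{ij}(x) − δ_{ij}| ≤ C''(1+|x|)^{2−2β} and |k_{ij}(x)| ≤ C''(1+|x|)^{−β}. -/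

import Mathlib

open scoped BigOperators
open Real Filter MeasureTheory

noncomputable section

/-- Partial derivative `∂ᵢ f (x)` on Euclidean space. -/
def pd {n : ℕ} (f : EuclideanSpace ℝ (Fin n) → ℝ) (i : Fin n)
    (x : EuclideanSpace ℝ (Fin n)) : ℝ :=
  fderiv ℝ f x (EuclideanSpace.single i 1)

/-- Euclidean Laplacian `Δ f (x) = ∑ i, ∂ᵢ∂ᵢ f (x)`. -/
def lap {n : ℕ} (f : EuclideanSpace ℝ (Fin n) → ℝ)
    (x : EuclideanSpace ℝ (Fin n)) : ℝ :=
  ∑ i, pd (pd f i) i x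

/-- Conformal Killing operator
`(LW)_{ij} = ∂ᵢ W_j + ∂_j W_i − (2 δ_{ij}/n) ∑ₖ ∂ₖ Wₖ`. -/
def cK {n : ℕ} (W : Fin n → EuclideanSpace ℝ (Fin n) → ℝ) (i j : Fin n)
    (x : EuclideanSpace ℝ (Fin n)) : ℝ :=
  pd (W j) i x + pd (W i) j x
    - (2 / (n : ℝ)) * (if i = j then (1 : ℝ) else 0) * ∑ k, pd (W k) k x

/-- The critical exponent `N = 2n/(n−2)`. -/
def Nc (n : ℕ) : ℝ := 2 * n / ((n : ℝ) - 2)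

/-- The vacuum Einstein conformal constraint equations on `ℝⁿ` (flat background,
`σ ≡ 0`): the Lichnerowicz equation together with the vector equations. -/
def SolvesCCE (n : ℕ) (φ τ : EuclideanSpace ℝ (Fin n) → ℝ)
    (W : Fin n → EuclideanSpace ℝ (Fin n) → ℝ) : Prop :=
  (∀ x, -(4 * ((n : ℝ) - 1) / ((n : ℝ) - 2)) * lap φ x
      + (((n : ℝ) - 1) / (n : ℝ)) * (τ x) ^ 2 * (φ x) ^ (Nc n - 1)
      = (∑ i, ∑ j, (cK W i j x) ^ 2) * (φ x) ^ (-(Nc n) - 1)) ∧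
  (∀ i, ∀ x, lap (W i) x
      + (((n : ℝ) - 2) / (n : ℝ)) * pd (fun y => ∑ j, pd (W j) j y) i x
      = (((n : ℝ) - 1) / (n : ℝ)) * (φ x) ^ (Nc n) * pd τ i x)

/-- The second fundamental form `k_{ij} = (τ/n) φ^{N−2} δ_{ij} + φ^{−2} (LW)_{ij}`
produced by the conformal method. -/
def kTen (n : ℕ) (φ τ : EuclideanSpace ℝ (Fin n) → ℝ)
    (W : Fin n → EuclideanSpace ℝ (Fin n) → ℝ) (i j : Fin n)
    (x : EuclideanSpace ℝ (Fin n)) : ℝ :=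
  (τ x / (n : ℝ)) * (φ x) ^ (Nc n - 2) * (if i = j then (1 : ℝ) else 0)
    + (φ x) ^ (-2 : ℝ) * cK W i j x

/-- The weighted average `∫₀¹ σ^d g(ρσ) dσ`; for `ρ ≠ 0` it equals `ρ^{-d-1} ∫₀^ρ t^d g(t) dt`. -/
def radAvg (d : ℕ) (g : ℝ → ℝ) (ρ : ℝ) : ℝ := ∫ σ in (0 : ℝ)..1, σ ^ d * g (ρ * σ)

theorem continuous_radAvg (d : ℕ) {g : ℝ → ℝ} (hg : Continuous g) : Continuous (radAvg d g) := by
  unfold radAvg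
  apply intervalIntegral.continuous_parametric_intervalIntegral_of_continuous'
  fun_prop

theorem intervalIntegrable_radAvg (d : ℕ) {g : ℝ → ℝ} (hg : Continuous g) (ρ : ℝ) :
    IntervalIntegrable (fun σ : ℝ => σ ^ d * g (ρ * σ)) volume 0 1 := by
  apply Continuous.intervalIntegrable
  fun_prop

theorem hasDerivAt_radAvg (d : ℕ) {g g' : ℝ → ℝ} (hg : ∀ t, HasDerivAt g (g' t) t)
    (hg' : Continuous g') (ρ : ℝ) : HasDerivAt (radAvg d g) (radAvg (d + 1) g' ρ) ρ := by
  have hgc : Continuous g := continuous_iff_continuousAt.2 fun t => (hg t).continuousAt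
  obtain ⟨B, hB⟩ := (isCompact_Icc (a := -(|ρ| + 1)) (b := |ρ| + 1)).exists_bound_of_continuousOn
    hg'.continuousOn
  refine (intervalIntegral.hasDerivAt_integral_of_dominated_loc_of_deriv_le
    (F := fun ρ σ => σ ^ d * g (ρ * σ)) (F' := fun ρ σ => σ ^ (d + 1) * g' (ρ * σ))
    (s := Metric.ball ρ 1) (bound := fun _ => B) (Metric.ball_mem_nhds _ one_pos)
    (Eventually.of_forall fun x => ?_) (intervalIntegrable_radAvg d hgc ρ) ?_
    (Eventually.of_forall fun σ hσ x hx => ?_) (by simp)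
    (Eventually.of_forall fun σ _ x _ => ?_)).2
  · exact Continuous.aestronglyMeasurable (by fun_prop)
  · exact Continuous.aestronglyMeasurable (by fun_prop)
  · rw [Set.uIoc_of_le zero_le_one] at hσ
    rw [norm_mul, norm_pow, Real.norm_of_nonneg hσ.1.le]
    have h1 : σ ^ (d + 1) ≤ 1 := pow_le_one₀ hσ.1.le hσ.2
    have h2 : |x * σ| ≤ |ρ| + 1 := by
      rw [abs_mul, abs_of_pos hσ.1]
      have : |x| ≤ |ρ| + 1 := by
        have h3 : |x - ρ| < 1 := by simpa [Real.dist_eq] using hx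
        have := abs_sub_abs_le_abs_sub x ρ
        linarith
      calc |x| * σ ≤ |x| * 1 := by gcongr; exact hσ.2
        _ ≤ _ := by linarith
    have h3 := hB (x * σ) (abs_le.1 h2)
    calc σ ^ (d + 1) * ‖g' (x * σ)‖ ≤ 1 * B := by
          gcongr
      _ = B := one_mul B
  · have h := ((hg (x * σ)).comp x ((hasDerivAt_id x).mul_const σ)).const_mul (σ ^ d)
    refine h.congr_deriv ?_
    ring

/-- Euler's identity for the weighted average. -/
theorem mul_radAvg_succ (d : ℕ) {g g' : ℝ → ℝ} (hg : ∀ t, HasDerivAt g (g' t) t)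
    (hg' : Continuous g') (ρ : ℝ) :
    ρ * radAvg (d + 1) g' ρ = g ρ - (d + 1) * radAvg d g ρ := by
  have hgc : Continuous g := continuous_iff_continuousAt.2 fun t => (hg t).continuousAt
  have key := intervalIntegral.integral_eq_sub_of_hasDerivAt (a := (0 : ℝ)) (b := 1)
    (f := fun σ => σ ^ (d + 1) * g (ρ * σ))
    (f' := fun σ => ((d : ℝ) + 1) * (σ ^ d * g (ρ * σ)) + ρ * (σ ^ (d + 1) * g' (ρ * σ)))
    (fun σ _ => ?_) (Continuous.intervalIntegrable (by fun_prop) _ _)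
  · rw [intervalIntegral.integral_add ((intervalIntegrable_radAvg d hgc ρ).const_mul _)
      ((intervalIntegrable_radAvg (d + 1) hg' ρ).const_mul _),
      intervalIntegral.integral_const_mul, intervalIntegral.integral_const_mul] at key
    simp only [radAvg]
    simp at key
    linarith
  · have h := (hasDerivAt_pow (d + 1) σ).mul
      ((hg (ρ * σ)).comp σ ((hasDerivAt_id σ).const_mul ρ))
    refine h.congr_deriv ?_
    simp
    ring

theorem abs_radAvg_le (d : ℕ) {g : ℝ → ℝ} {s β K : ℝ} (hs : 0 ≤ s)
    (hβ : 0 ≤ β) (hβd : β ≤ d) (hK : 0 ≤ K)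
    (hgK : ∀ t, 0 ≤ t → t ≤ s → |g t| ≤ K * (1 + t) ^ (-β)) :
    |radAvg d g s| ≤ K * (1 + s) ^ (-β) := by
  have h := intervalIntegral.norm_integral_le_of_norm_le_const (a := (0 : ℝ)) (b := 1)
    (f := fun σ : ℝ => σ ^ d * g (s * σ)) (C := K * (1 + s) ^ (-β)) (fun σ hσ => ?_)
  · simpa [radAvg] using h
  · rw [Set.uIoc_of_le zero_le_one] at hσ
    obtain ⟨hσ0, hσ1⟩ := hσ
    rw [norm_mul, norm_pow, Real.norm_of_nonneg hσ0.le, Real.norm_eq_abs]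
    have h1 := hgK (s * σ) (by positivity) (mul_le_of_le_one_right hs hσ1)
    have h2 : (1 + s * σ) ^ (-β) ≤ (σ * (1 + s)) ^ (-β) :=
      Real.rpow_le_rpow_of_nonpos (by positivity) (by nlinarith) (by linarith)
    rw [Real.mul_rpow hσ0.le (by positivity)] at h2
    have h3 : σ ^ d * σ ^ (-β) ≤ 1 := by
      rw [← Real.rpow_natCast, ← Real.rpow_add hσ0]
      exact Real.rpow_le_one hσ0.le hσ1 (by linarith)
    calc σ ^ d * |g (s * σ)| ≤ σ ^ d * (K * (σ ^ (-β) * (1 + s) ^ (-β))) := by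
          gcongr
          exact h1.trans (by gcongr)
      _ = (σ ^ d * σ ^ (-β)) * (K * (1 + s) ^ (-β)) := by ring
      _ ≤ 1 * (K * (1 + s) ^ (-β)) := by gcongr
      _ = _ := one_mul _

theorem radAvg_sub (d : ℕ) {g h : ℝ → ℝ} (hg : Continuous g) (hh : Continuous h) (s : ℝ) :
    radAvg d g s - radAvg d h s = radAvg d (fun t => g t - h t) s := by
  unfold radAvg
  rw [← intervalIntegral.integral_sub (intervalIntegrable_radAvg d hg s)
    (intervalIntegrable_radAvg d hh s)]
  congr 1
  ext σ
  ring

theorem radAvg_even (d : ℕ) {g : ℝ → ℝ} (hg : ∀ t, g (-t) = g t) (s : ℝ) :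
    radAvg d g (-s) = radAvg d g s := by
  simp [radAvg, hg]

/-- The Lorentz factor `√(1 + x²)`. -/
def lor (x : ℝ) : ℝ := √(1 + x ^ 2)

theorem one_le_lor (x : ℝ) : 1 ≤ lor x := by
  unfold lor
  rw [Real.one_le_sqrt]
  nlinarith [sq_nonneg x]

theorem lor_pos (x : ℝ) : 0 < lor x := one_pos.trans_le (one_le_lor x)

theorem lor_sq (x : ℝ) : lor x ^ 2 = 1 + x ^ 2 := Real.sq_sqrt (by positivity)

theorem hasDerivAt_lor (x : ℝ) : HasDerivAt lor (x / lor x) x := by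
  have h := ((hasDerivAt_pow 2 x).const_add 1).sqrt (by positivity)
  refine h.congr_deriv ?_
  have := lor_pos x
  simp only [lor] at this ⊢
  field_simp
  ring

theorem continuous_lor : Continuous lor :=
  continuous_iff_continuousAt.2 fun x => (hasDerivAt_lor x).continuousAt

/-- `(1 - (1 + s²κ²)^{-1/2}) / s`, written without the singularity at `s = 0`. -/
def eta (s κ : ℝ) : ℝ := s * κ ^ 2 / (lor (s * κ) * (1 + lor (s * κ)))

theorem continuous_eta {k : ℝ → ℝ} (hk : Continuous k) : Continuous fun s => eta s (k s) := by
  unfold eta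
  have := continuous_lor
  refine Continuous.div (by fun_prop) (by fun_prop) fun s => ?_
  have := lor_pos (s * k s)
  positivity

theorem eta_nonneg {s : ℝ} (hs : 0 ≤ s) (κ : ℝ) : 0 ≤ eta s κ := by
  have := lor_pos (s * κ)
  unfold eta
  positivity

theorem eta_neg (s κ : ℝ) : eta (-s) κ = -eta s κ := by
  have : lor (-s * κ) = lor (s * κ) := by simp [lor]
  simp only [eta, this]
  ring

theorem eta_le {s : ℝ} (hs : 0 ≤ s) (κ : ℝ) : eta s κ ≤ s * κ ^ 2 := by
  have := one_le_lor (s * κ)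
  unfold eta
  apply div_le_self (by positivity)
  nlinarith

theorem eta_sub_le {s a b K : ℝ} (hs : 0 ≤ s) (ha : |a| ≤ K) (hb : |b| ≤ K) :
    |eta s a - eta s b| ≤ s * K * |a - b| := by
  rcases hs.eq_or_lt with rfl | hs
  · simp [eta]
  have e : ∀ κ, eta s κ = (1 - 1 / lor (s * κ)) / s := by
    intro κ
    have h1 := lor_pos (s * κ)
    have h2 := lor_sq (s * κ)
    unfold eta
    field_simp
    linear_combination -h2
  set A := lor (s * a) with hA
  set B := lor (s * b) with hB
  have hA1 : 1 ≤ A := one_le_lor _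
  have hB1 : 1 ≤ B := one_le_lor _
  have hA2 : A ^ 2 = 1 + (s * a) ^ 2 := lor_sq _
  have hB2 : B ^ 2 = 1 + (s * b) ^ 2 := lor_sq _
  have h : eta s a - eta s b = s * (a - b) * ((a + b) / (A * B * (A + B))) := by
    rw [e, e, ← hA, ← hB]
    field_simp
    linear_combination hA2 - hB2
  have hab : |a + b| ≤ 2 * K := (abs_add_le a b).trans (by linarith)
  have hAB : 2 ≤ A * B * (A + B) := by nlinarith [mul_nonneg (sub_nonneg.2 hA1) (sub_nonneg.2 hB1)]
  have h2 : |(a + b) / (A * B * (A + B))| ≤ K := by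
    rw [abs_div, abs_of_pos (by positivity : 0 < A * B * (A + B)), div_le_iff₀ (by positivity)]
    have : 0 ≤ K := (abs_nonneg a).trans ha
    nlinarith
  rw [h, abs_mul, abs_mul, abs_of_pos hs]
  calc s * |a - b| * |(a + b) / (A * B * (A + B))| ≤ s * |a - b| * K := by gcongr
    _ = _ := by ring

/-- A `C¹` profile on the line decaying like `|s|^{-β}`, with `β` in the admissible range. -/
structure DecayProfile (d : ℕ) (β C : ℝ) (τ τ' : ℝ → ℝ) : Prop where
  hasDerivAt : ∀ s, HasDerivAt τ (τ' s) s
  continuous_deriv : Continuous τ'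
  abs_le : ∀ s, |τ s| ≤ C * (1 + |s|) ^ (-β)
  abs_deriv_le : ∀ s, |τ' s| ≤ C * (1 + |s|) ^ (-β - 1)
  one_lt : 1 < β
  le_dim : β ≤ d
  pos : 0 < C

/-- The profile `τ` evaluated at radius `t e^{m(t)}`, where `m` is truncated below at `0`. -/
def truncProfile (τ m : ℝ → ℝ) (t : ℝ) : ℝ := τ (t * Real.exp (max (m t) 0))

/-- The integrand of the Volterra equation satisfied by `m`. -/
def voltKer (d : ℕ) (τ m : ℝ → ℝ) (s : ℝ) : ℝ := eta s (radAvg d (truncProfile τ m) s)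

/-- A primitive of `C² (1 + s)^{1 - 2β}` vanishing at `0`. -/
def weightPrim (β C ρ : ℝ) : ℝ := C ^ 2 / (2 * β - 2) * (1 - (1 + ρ) ^ (2 - 2 * β))

namespace DecayProfile

variable {d : ℕ} {β C : ℝ} {τ τ' : ℝ → ℝ}

theorem continuous (h : DecayProfile d β C τ τ') : Continuous τ :=
  continuous_iff_continuousAt.2 fun t => (h.hasDerivAt t).continuousAt

theorem continuous_truncProfile (h : DecayProfile d β C τ τ') {m : ℝ → ℝ} (hm : Continuous m) :
    Continuous (truncProfile τ m) := by
  have := h.continuous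
  unfold truncProfile
  fun_prop

theorem abs_dilate_le (h : DecayProfile d β C τ τ') {t a : ℝ} (ht : 0 ≤ t) (ha : 0 ≤ a) :
    |τ (t * Real.exp a)| ≤ C * (1 + t) ^ (-β) := by
  refine (h.abs_le _).trans ?_
  have h1 : 1 ≤ Real.exp a := Real.one_le_exp ha
  have hC := h.pos
  rw [abs_of_nonneg (by positivity)]
  gcongr ?_ * ?_
  exact Real.rpow_le_rpow_of_nonpos (by positivity) (by nlinarith) (by linarith [h.one_lt])

theorem abs_dilate_sub_le (h : DecayProfile d β C τ τ') {t a b : ℝ} (ht : 0 ≤ t)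
    (ha : 0 ≤ a) (hb : 0 ≤ b) :
    |τ (t * Real.exp a) - τ (t * Real.exp b)| ≤ C * (1 + t) ^ (-β) * |a - b| := by
  refine (convex_Ici (0 : ℝ)).norm_image_sub_le_of_norm_hasDerivWithin_le
    (f := fun x => τ (t * Real.exp x)) (f' := fun x => τ' (t * Real.exp x) * (t * Real.exp x))
    (fun x _ => ?_) (fun x hx => ?_) (Set.mem_Ici.2 hb) (Set.mem_Ici.2 ha)
  · exact ((h.hasDerivAt _).comp x ((Real.hasDerivAt_exp x).const_mul t)).hasDerivWithinAt
  · have hC := h.pos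
    have h1 : 1 ≤ Real.exp x := Real.one_le_exp hx
    have h2 := h.abs_deriv_le (t * Real.exp x)
    rw [abs_of_nonneg (by positivity : 0 ≤ t * Real.exp x)] at h2
    have hp : 0 < 1 + t * Real.exp x := by positivity
    rw [norm_mul, Real.norm_eq_abs, Real.norm_of_nonneg (by positivity)]
    calc |τ' (t * Real.exp x)| * (t * Real.exp x)
        ≤ C * (1 + t * Real.exp x) ^ (-β - 1) * (1 + t * Real.exp x) := by
          gcongr
          linarith
      _ = C * (1 + t * Real.exp x) ^ (-β) := by
          rw [Real.rpow_sub_one hp.ne']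
          field_simp
      _ ≤ C * (1 + t) ^ (-β) := by
          gcongr ?_ * ?_
          exact Real.rpow_le_rpow_of_nonpos (by positivity) (by nlinarith) (by linarith [h.one_lt])

theorem abs_radAvg_truncProfile_le (h : DecayProfile d β C τ τ') (m : ℝ → ℝ) {s : ℝ} (hs : 0 ≤ s) :
    |radAvg d (truncProfile τ m) s| ≤ C * (1 + s) ^ (-β) :=
  abs_radAvg_le d hs (by linarith [h.one_lt]) h.le_dim h.pos.le fun _ ht _ =>
    h.abs_dilate_le ht (le_max_right _ _)

theorem mul_decay_sq_le (h : DecayProfile d β C τ τ') {s : ℝ} (hs : 0 ≤ s) :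
    s * (C * (1 + s) ^ (-β)) * (C * (1 + s) ^ (-β)) ≤ C ^ 2 * (1 + s) ^ (1 - 2 * β) := by
  have hp : 0 < 1 + s := by positivity
  have e : (1 + s) ^ (1 - 2 * β) = (1 + s) * ((1 + s) ^ (-β) * (1 + s) ^ (-β)) := by
    rw [← Real.rpow_add hp, ← Real.rpow_one_add' hp.le]
    · ring_nf
    · linarith [h.one_lt]
  rw [e]
  have : 0 < (1 + s) ^ (-β) := by positivity
  have h3 : 0 ≤ C ^ 2 * ((1 + s) ^ (-β) * (1 + s) ^ (-β)) := by positivity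
  nlinarith

theorem continuous_voltKer (h : DecayProfile d β C τ τ') {m : ℝ → ℝ} (hm : Continuous m) :
    Continuous (voltKer d τ m) :=
  continuous_eta (continuous_radAvg d (h.continuous_truncProfile hm))

theorem voltKer_nonneg (d : ℕ) (τ m : ℝ → ℝ) {s : ℝ} (hs : 0 ≤ s) : 0 ≤ voltKer d τ m s :=
  eta_nonneg hs _

theorem voltKer_le (h : DecayProfile d β C τ τ') (m : ℝ → ℝ) {s : ℝ} (hs : 0 ≤ s) :
    voltKer d τ m s ≤ C ^ 2 * (1 + s) ^ (1 - 2 * β) := by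
  refine (eta_le hs _).trans ((le_trans ?_ (h.mul_decay_sq_le hs)))
  have := h.abs_radAvg_truncProfile_le m hs
  rw [← sq_abs, pow_two, ← mul_assoc]
  have hC := h.pos
  have := abs_nonneg (radAvg d (truncProfile τ m) s)
  gcongr

theorem voltKer_sub_le (h : DecayProfile d β C τ τ') {m₁ m₂ : ℝ → ℝ}
    (h₁ : Continuous m₁) (h₂ : Continuous m₂) {s D : ℝ}
    (hs : 0 ≤ s) (hD : ∀ t, 0 ≤ t → t ≤ s → |m₁ t - m₂ t| ≤ D) :
    |voltKer d τ m₁ s - voltKer d τ m₂ s| ≤ C ^ 2 * (1 + s) ^ (1 - 2 * β) * D := by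
  have hC := h.pos
  have hD0 : 0 ≤ D := (abs_nonneg _).trans (hD 0 le_rfl hs)
  have key : |radAvg d (truncProfile τ m₁) s - radAvg d (truncProfile τ m₂) s|
      ≤ C * D * (1 + s) ^ (-β) := by
    rw [radAvg_sub d (h.continuous_truncProfile h₁) (h.continuous_truncProfile h₂)]
    refine abs_radAvg_le d hs (by linarith [h.one_lt]) h.le_dim (by positivity) fun t ht hts => ?_
    refine (h.abs_dilate_sub_le ht (le_max_right _ _) (le_max_right _ _)).trans ?_
    have : |max (m₁ t) 0 - max (m₂ t) 0| ≤ D :=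
      (abs_max_sub_max_le_abs _ _ _).trans (hD t ht hts)
    calc _ ≤ C * (1 + t) ^ (-β) * D := by gcongr
      _ = _ := by ring
  refine (eta_sub_le hs (h.abs_radAvg_truncProfile_le m₁ hs)
    (h.abs_radAvg_truncProfile_le m₂ hs)).trans ?_
  calc _ ≤ s * (C * (1 + s) ^ (-β)) * (C * D * (1 + s) ^ (-β)) := by gcongr
    _ = s * (C * (1 + s) ^ (-β)) * (C * (1 + s) ^ (-β)) * D := by ring
    _ ≤ _ := by gcongr ?_ * D; exact h.mul_decay_sq_le hs

theorem hasDerivAt_weightPrim (h : DecayProfile d β C τ τ') {ρ : ℝ} (hρ : 0 ≤ ρ) :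
    HasDerivAt (weightPrim β C) (C ^ 2 * (1 + ρ) ^ (1 - 2 * β)) ρ := by
  have hb := h.one_lt
  have h1 : HasDerivAt (fun ρ : ℝ => 1 + ρ) 1 ρ := (hasDerivAt_id ρ).const_add 1
  have h2 := ((h1.rpow_const (p := 2 - 2 * β) (Or.inl (by positivity))).const_sub 1).const_mul
    (C ^ 2 / (2 * β - 2))
  refine h2.congr_deriv ?_
  have : β - 1 ≠ 0 := by linarith
  rw [show 2 - 2 * β - 1 = 1 - 2 * β by ring, show 2 * β - 2 = 2 * (β - 1) by ring]
  field_simp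
  ring

theorem const_pos (h : DecayProfile d β C τ τ') : 0 < C ^ 2 / (2 * β - 2) :=
  div_pos (pow_pos h.pos 2) (by linarith [h.one_lt])

theorem weightPrim_mono (h : DecayProfile d β C τ τ') {ρ s : ℝ} (hρ : 0 ≤ ρ) (hs : ρ ≤ s) :
    weightPrim β C ρ ≤ weightPrim β C s := by
  have := h.const_pos
  unfold weightPrim
  gcongr _ * (1 - ?_)
  exact Real.rpow_le_rpow_of_nonpos (by positivity) (by linarith) (by linarith [h.one_lt])

theorem weightPrim_zero (β C : ℝ) : weightPrim β C 0 = 0 := by simp [weightPrim]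

theorem weightPrim_nonneg (h : DecayProfile d β C τ τ') {ρ : ℝ} (hρ : 0 ≤ ρ) :
    0 ≤ weightPrim β C ρ :=
  (weightPrim_zero β C).symm.le.trans (h.weightPrim_mono le_rfl hρ)

theorem weightPrim_le (h : DecayProfile d β C τ τ') {ρ : ℝ} (hρ : 0 ≤ ρ) :
    weightPrim β C ρ ≤ C ^ 2 / (2 * β - 2) := by
  have := h.const_pos
  unfold weightPrim
  apply mul_le_of_le_one_right this.le
  linarith [Real.rpow_nonneg (by positivity : 0 ≤ 1 + ρ) (2 - 2 * β)]

theorem continuous_weightPrim_abs (β C : ℝ) : Continuous fun ρ => weightPrim β C |ρ| := by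
  unfold weightPrim
  have : Continuous fun ρ : ℝ => (1 + |ρ|) ^ (2 - 2 * β) :=
    Continuous.rpow_const (by fun_prop) fun ρ => Or.inl (by positivity)
  fun_prop

theorem continuousOn_weight (β C : ℝ) :
    ContinuousOn (fun s => C ^ 2 * (1 + s) ^ (1 - 2 * β)) (Set.Ici 0) := by
  refine ContinuousOn.mul continuousOn_const (ContinuousOn.rpow_const (by fun_prop) fun s hs => ?_)
  left
  have : (0 : ℝ) ≤ s := hs
  positivity

theorem integral_voltKer_le (h : DecayProfile d β C τ τ') (m : ℝ → ℝ) (hm : Continuous m)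
    {a b : ℝ} (ha : 0 ≤ a) (hab : a ≤ b) :
    ∫ s in a..b, voltKer d τ m s ≤ weightPrim β C b - weightPrim β C a := by
  have hcont : ContinuousOn (fun s => C ^ 2 * (1 + s) ^ (1 - 2 * β)) (Set.uIcc a b) :=
    (continuousOn_weight β C).mono fun s hs => by
      rw [Set.uIcc_of_le hab] at hs
      exact ha.trans hs.1
  rw [← intervalIntegral.integral_eq_sub_of_hasDerivAt (f := weightPrim β C)
    (f' := fun s => C ^ 2 * (1 + s) ^ (1 - 2 * β)) (fun s hs => ?_) hcont.intervalIntegrable]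
  · refine intervalIntegral.integral_mono_on hab ((h.continuous_voltKer hm).intervalIntegrable _ _)
      hcont.intervalIntegrable fun s hs => h.voltKer_le m (ha.trans hs.1)
  · rw [Set.uIcc_of_le hab] at hs
    exact h.hasDerivAt_weightPrim (ha.trans hs.1)

theorem integral_voltKer_nonneg (d : ℕ) (τ m : ℝ → ℝ) {a b : ℝ} (ha : 0 ≤ a) (hab : a ≤ b) :
    0 ≤ ∫ s in a..b, voltKer d τ m s :=
  intervalIntegral.integral_nonneg hab fun _ hs => voltKer_nonneg d τ m (ha.trans hs.1)

theorem integral_voltKer_sub_le (h : DecayProfile d β C τ τ') {m₁ m₂ : ℝ → ℝ}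
    (h₁ : Continuous m₁) (h₂ : Continuous m₂)
    {ρ D : ℝ} (hρ : 0 ≤ ρ)
    (hD : ∀ t, 0 ≤ t → |m₁ t - m₂ t| ≤ D * Real.exp (2 * weightPrim β C t)) :
    |(∫ s in (0 : ℝ)..ρ, voltKer d τ m₁ s) - ∫ s in (0 : ℝ)..ρ, voltKer d τ m₂ s|
      ≤ D / 2 * Real.exp (2 * weightPrim β C ρ) := by
  have hD0 : 0 ≤ D := by
    have := (abs_nonneg _).trans (hD 0 le_rfl)
    exact nonneg_of_mul_nonneg_left this (Real.exp_pos _)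
  rw [← intervalIntegral.integral_sub ((h.continuous_voltKer h₁).intervalIntegrable _ _)
    ((h.continuous_voltKer h₂).intervalIntegrable _ _)]
  have hder : ∀ s ∈ Set.uIcc 0 ρ, HasDerivAt (fun s => D / 2 * Real.exp (2 * weightPrim β C s))
      (C ^ 2 * (1 + s) ^ (1 - 2 * β) * (D * Real.exp (2 * weightPrim β C s))) s := by
    intro s hs
    rw [Set.uIcc_of_le hρ] at hs
    refine (((h.hasDerivAt_weightPrim hs.1).const_mul 2).exp.const_mul (D / 2)).congr_deriv ?_
    ring
  have hcont : ContinuousOn (fun s => C ^ 2 * (1 + s) ^ (1 - 2 * β) *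
      (D * Real.exp (2 * weightPrim β C s))) (Set.uIcc 0 ρ) := by
    have h1 : ContinuousOn (weightPrim β C) (Set.uIcc 0 ρ) := fun s hs => by
      rw [Set.uIcc_of_le hρ] at hs
      exact (h.hasDerivAt_weightPrim hs.1).continuousAt.continuousWithinAt
    have h2 := (continuousOn_weight β C).mono (s := Set.Ici 0) (t := Set.uIcc 0 ρ)
      fun s hs => by
        rw [Set.uIcc_of_le hρ] at hs
        exact hs.1
    fun_prop
  have key := intervalIntegral.norm_integral_le_of_norm_le (μ := volume) hρ
    (f := fun s => voltKer d τ m₁ s - voltKer d τ m₂ s)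
    (g := fun s => C ^ 2 * (1 + s) ^ (1 - 2 * β) * (D * Real.exp (2 * weightPrim β C s)))
    (Eventually.of_forall fun s hs => h.voltKer_sub_le h₁ h₂ hs.1.le fun t ht hts =>
      (hD t ht).trans ?_) hcont.intervalIntegrable
  · rw [intervalIntegral.integral_eq_sub_of_hasDerivAt hder hcont.intervalIntegrable] at key
    refine key.trans ?_
    have : 0 ≤ D / 2 * Real.exp (2 * weightPrim β C 0) := by positivity
    linarith
  · gcongr
    exact h.weightPrim_mono ht hts

theorem abs_integral_voltKer_le (h : DecayProfile d β C τ τ') {m : ℝ → ℝ}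
    (hm : Continuous m) (ρ : ℝ) :
    |∫ s in (0 : ℝ)..|ρ|, voltKer d τ m s| ≤ C ^ 2 / (2 * β - 2) := by
  rw [abs_of_nonneg (integral_voltKer_nonneg d τ m le_rfl (abs_nonneg ρ))]
  have h1 := h.integral_voltKer_le m hm le_rfl (abs_nonneg ρ)
  have h2 := h.weightPrim_le (abs_nonneg ρ)
  rw [(weightPrim_zero β C)] at h1
  linarith

/-- Solvability of the Volterra equation, with Lipschitz dependence on the initial value. -/
theorem exists_volterra (h : DecayProfile d β C τ τ') :
    ∃ (m : ℝ → ℝ → ℝ) (K : ℝ), (∀ a, Continuous (m a)) ∧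
    (∀ a ρ, m a ρ = a - ∫ s in (0 : ℝ)..|ρ|, voltKer d τ (m a) s) ∧
    ∀ a b ρ, |m a ρ - m b ρ| ≤ K * |a - b| := by
  set wt : ℝ → ℝ := fun ρ => Real.exp (2 * weightPrim β C |ρ|) with hwt
  have hwtc : Continuous wt := by
    have := continuous_weightPrim_abs β C
    fun_prop
  have hwt1 : ∀ ρ, 1 ≤ wt ρ := fun ρ =>
    Real.one_le_exp (by linarith [h.weightPrim_nonneg (abs_nonneg ρ)])
  have hwt0 : ∀ ρ, 0 < wt ρ := fun ρ => Real.exp_pos _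
  have hwtB : ∀ ρ, wt ρ ≤ Real.exp (2 * (C ^ 2 / (2 * β - 2))) := fun ρ =>
    Real.exp_le_exp.2 (by linarith [h.weightPrim_le (abs_nonneg ρ)])
  let ext : BoundedContinuousFunction ℝ ℝ → ℝ → ℝ := fun v ρ => wt ρ * v ρ
  have hext : ∀ v, Continuous (ext v) := fun v => hwtc.mul v.continuous
  have hcont : ∀ a v, Continuous fun ρ : ℝ =>
      (wt ρ)⁻¹ * (a - ∫ s in (0 : ℝ)..|ρ|, voltKer d τ (ext v) s) := fun a v => by
    have h1 := intervalIntegral.continuous_primitive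
      (fun a b => (h.continuous_voltKer (hext v)).intervalIntegrable (μ := volume) a b) 0
    have h2 := hwtc.inv₀ fun ρ => (hwt0 ρ).ne'
    have h3 := h1.comp continuous_abs
    exact h2.mul (continuous_const.sub h3)
  let S : ℝ → BoundedContinuousFunction ℝ ℝ → BoundedContinuousFunction ℝ ℝ := fun a v =>
    BoundedContinuousFunction.ofNormedAddCommGroup _ (hcont a v) (|a| + C ^ 2 / (2 * β - 2))
      fun ρ => by
        rw [norm_mul, norm_inv, Real.norm_of_nonneg (hwt0 ρ).le, Real.norm_eq_abs]
        have h1 := h.abs_integral_voltKer_le (hext v) ρ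
        have h2 := abs_sub a (∫ s in (0 : ℝ)..|ρ|, voltKer d τ (ext v) s)
        calc _ ≤ 1 * |a - ∫ s in (0 : ℝ)..|ρ|, voltKer d τ (ext v) s| := by
              gcongr
              exact inv_le_one_of_one_le₀ (hwt1 ρ)
          _ ≤ _ := by linarith
  have hS : ∀ a v ρ, S a v ρ = (wt ρ)⁻¹ * (a - ∫ s in (0 : ℝ)..|ρ|, voltKer d τ (ext v) s) :=
    fun a v ρ => rfl
  have hcontr : ∀ a, ContractingWith (1 / 2) (S a) := fun a => by
    refine ⟨by norm_num [← NNReal.coe_lt_coe], LipschitzWith.of_dist_le_mul fun v₁ v₂ => ?_⟩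
    rw [BoundedContinuousFunction.dist_le (by positivity)]
    intro ρ
    have h1 := h.integral_voltKer_sub_le (hext v₁) (hext v₂) (abs_nonneg ρ) (D := dist v₁ v₂)
      fun t ht => by
        simp only [ext]
        rw [← mul_sub, abs_mul, abs_of_pos (hwt0 t), mul_comm, ← Real.dist_eq]
        simp only [hwt, abs_of_nonneg ht]
        gcongr
        exact BoundedContinuousFunction.dist_coe_le_dist t
    rw [Real.dist_eq, hS, hS, ← mul_sub, abs_mul, abs_of_pos (inv_pos.2 (hwt0 ρ)),
      sub_sub_sub_cancel_left, abs_sub_comm, inv_mul_le_iff₀ (hwt0 ρ)]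
    refine h1.trans (le_of_eq ?_)
    simp only [hwt]
    push_cast
    ring
  let v : ℝ → BoundedContinuousFunction ℝ ℝ := fun a => (hcontr a).fixedPoint (S a)
  have hv : ∀ a, S a (v a) = v a := fun a => (hcontr a).fixedPoint_isFixedPt
  have hvd : ∀ a b, dist (v a) (v b) ≤ |a - b| / (1 - (1 / 2 : NNReal)) := fun a b => by
    refine (hcontr a).fixedPoint_lipschitz_in_map (hcontr b) fun z => ?_
    rw [BoundedContinuousFunction.dist_le (abs_nonneg _)]
    intro ρ
    rw [Real.dist_eq, hS, hS, ← mul_sub, abs_mul, abs_of_pos (inv_pos.2 (hwt0 ρ)),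
      sub_sub_sub_cancel_right]
    exact mul_le_of_le_one_left (abs_nonneg _) (inv_le_one_of_one_le₀ (hwt1 ρ))
  refine ⟨fun a => ext (v a), Real.exp (2 * (C ^ 2 / (2 * β - 2))) * 2, fun a => hext _,
    fun a ρ => ?_, fun a b ρ => ?_⟩
  · have h1 := hS a (v a) ρ
    rw [hv] at h1
    simp only [ext] at h1 ⊢
    rw [h1, mul_inv_cancel_left₀ (hwt0 ρ).ne']
  · simp only [ext]
    rw [← mul_sub, abs_mul, abs_of_pos (hwt0 ρ), ← Real.dist_eq, mul_assoc]
    gcongr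
    · exact hwtB ρ
    · refine (BoundedContinuousFunction.dist_coe_le_dist ρ).trans ((hvd a b).trans (le_of_eq ?_))
      push_cast
      ring

/-- Shooting: some solution of the Volterra equation tends to `0` at infinity. -/
theorem exists_volterra_tendsto_zero (h : DecayProfile d β C τ τ') :
    ∃ (a : ℝ) (m : ℝ → ℝ), Continuous m ∧
    (∀ ρ, m ρ = a - ∫ s in (0 : ℝ)..|ρ|, voltKer d τ m s) ∧ Tendsto m atTop (nhds 0) := by
  obtain ⟨m, K, hmc, hm, hK⟩ := h.exists_volterra
  have hlim : ∀ a, ∃ l, Tendsto (m a) atTop (nhds l) ∧ a - C ^ 2 / (2 * β - 2) ≤ l ∧ l ≤ a := by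
    intro a
    have hanti : Antitone fun ρ => m a (max ρ 0) := fun x y hxy => by
      have hx : 0 ≤ max x 0 := le_max_right _ _
      have hy : 0 ≤ max y 0 := le_max_right _ _
      have hxy' : max x 0 ≤ max y 0 := max_le_max hxy le_rfl
      have h1 := integral_voltKer_nonneg d τ (m a) hx hxy'
      have h2 := intervalIntegral.integral_add_adjacent_intervals
        ((h.continuous_voltKer (hmc a)).intervalIntegrable (μ := volume) 0 (max x 0))
        ((h.continuous_voltKer (hmc a)).intervalIntegrable (max x 0) (max y 0))
      simp only
      rw [hm, hm, abs_of_nonneg hx, abs_of_nonneg hy]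
      linarith
    have hlow : ∀ ρ, a - C ^ 2 / (2 * β - 2) ≤ m a ρ := fun ρ => by
      rw [hm]
      linarith [le_of_abs_le (h.abs_integral_voltKer_le (hmc a) ρ)]
    have hup : ∀ ρ, m a ρ ≤ a := fun ρ => by
      rw [hm]
      linarith [integral_voltKer_nonneg d τ (m a) le_rfl (abs_nonneg ρ)]
    have ht := tendsto_atTop_ciInf hanti ⟨_, by rintro _ ⟨ρ, rfl⟩; exact hlow _⟩
    have ht' : Tendsto (m a) atTop (nhds (⨅ ρ, m a (max ρ 0))) :=
      ht.congr' ((eventually_ge_atTop 0).mono fun ρ hρ => by simp [hρ])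
    exact ⟨_, ht', ge_of_tendsto' ht' hlow, le_of_tendsto' ht' hup⟩
  choose l hl hlb hla using hlim
  have hlip : ∀ a b, dist (l a) (l b) ≤ (Real.toNNReal K) * dist a b := fun a b => by
    rw [Real.dist_eq, Real.dist_eq]
    refine le_of_tendsto' ((hl a).sub (hl b)).abs fun ρ => (hK a b ρ).trans ?_
    gcongr
    exact Real.le_coe_toNNReal K
  have hlc : Continuous l := (LipschitzWith.of_dist_le_mul hlip).continuous
  have hB := h.const_pos
  obtain ⟨a, -, ha⟩ := intermediate_value_Icc hB.le hlc.continuousOn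
    (show (0 : ℝ) ∈ Set.Icc (l 0) (l (C ^ 2 / (2 * β - 2))) from
      ⟨hla 0, by linarith [hlb (C ^ 2 / (2 * β - 2))]⟩)
  exact ⟨a, m a, hmc a, hm a, ha ▸ hl a⟩

end DecayProfile

/-- Radial solution of the conformal constraints in one-dimensional form: the conformal factor is
`exp (-(n-2)/2 * μ)` with `n = d + 1`, and `k` is the tangential eigenvalue of the second
fundamental form. -/
structure RadialSolution (d : ℕ) (β B : ℝ) (τ μ k k' : ℝ → ℝ) : Prop where
  hasDerivAt_mu : ∀ r, HasDerivAt μ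
    (-(r * Real.exp (-2 * μ r) * k r ^ 2 / (1 + lor (r * Real.exp (-μ r) * k r)))) r
  hasDerivAt_k : ∀ r, HasDerivAt k (k' r) r
  continuous_deriv_k : Continuous k'
  deriv_k_zero : k' 0 = 0
  mul_deriv_k : ∀ r, r * k' r = lor (r * Real.exp (-μ r) * k r) * (τ r - (d + 1) * k r)
  mu_nonneg : ∀ r, 0 ≤ μ r
  mu_le : ∀ r, μ r ≤ B * (1 + |r|) ^ (2 - 2 * β)
  abs_k_le : ∀ r, |k r| ≤ B * (1 + |r|) ^ (-β)
  bound_pos : 0 < B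

theorem deriv_zero_of_even {f f' : ℝ → ℝ} (hf : ∀ s, HasDerivAt f (f' s) s)
    (he : ∀ s, f (-s) = f s) : f' 0 = 0 := by
  have h1 := (hf (-0)).comp (0 : ℝ) (hasDerivAt_neg (0 : ℝ))
  have h2 : f ∘ Neg.neg = f := funext he
  rw [h2] at h1
  have h3 := h1.unique (hf 0)
  rw [neg_zero] at h3
  linarith

namespace DecayProfile

variable {d : ℕ} {β C : ℝ} {τ τ' : ℝ → ℝ}

/-- The solution in the areal radius `ρ`: the coordinate radius is `ρ e^{m(ρ)}`. -/
theorem exists_areal (h : DecayProfile d β C τ τ') (hτ : ∀ s, τ (-s) = τ s) :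
    ∃ m κ κ' : ℝ → ℝ, (∀ ρ, HasDerivAt m (-eta ρ (κ ρ)) ρ) ∧ (∀ ρ, HasDerivAt κ (κ' ρ) ρ) ∧
      Continuous κ' ∧ κ' 0 = 0 ∧
      (∀ ρ, ρ * κ' ρ = τ (ρ * Real.exp (m ρ)) - (d + 1) * κ ρ) ∧ (∀ ρ, 0 ≤ m ρ) ∧
      (∀ ρ, m ρ ≤ C ^ 2 / (2 * β - 2) * (1 + |ρ|) ^ (2 - 2 * β)) ∧
      ∀ ρ, |κ ρ| ≤ C * (1 + |ρ|) ^ (-β) := by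
  obtain ⟨a, m, hmc, hm, hlim⟩ := h.exists_volterra_tendsto_zero
  have hmeven : ∀ ρ, m (-ρ) = m ρ := fun ρ => by rw [hm, hm, abs_neg]
  have hdiff : ∀ x y, 0 ≤ x → x ≤ y → 0 ≤ m x - m y ∧
      m x - m y ≤ weightPrim β C y - weightPrim β C x := fun x y hx hxy => by
    have h1 := integral_voltKer_nonneg d τ m hx hxy
    have h2 := intervalIntegral.integral_add_adjacent_intervals
      ((h.continuous_voltKer hmc).intervalIntegrable (μ := volume) 0 x)
      ((h.continuous_voltKer hmc).intervalIntegrable x y)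
    have h3 := h.integral_voltKer_le m hmc hx hxy
    rw [hm x, hm y, abs_of_nonneg hx, abs_of_nonneg (hx.trans hxy)]
    constructor <;> linarith
  have habs : ∀ ρ, m ρ = m |ρ| := fun ρ => by rw [hm, hm |ρ|, abs_abs]
  have hm0 : ∀ ρ, 0 ≤ m ρ := fun ρ => by
    rw [habs]
    refine le_of_tendsto hlim ((eventually_ge_atTop |ρ|).mono fun y hy => ?_)
    linarith [(hdiff _ y (abs_nonneg ρ) hy).1]
  have hmB : ∀ ρ, m ρ ≤ C ^ 2 / (2 * β - 2) * (1 + |ρ|) ^ (2 - 2 * β) := fun ρ => by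
    rw [habs, ← sub_zero (m |ρ|)]
    refine le_of_tendsto (hlim.const_sub (m |ρ|)) ((eventually_ge_atTop |ρ|).mono fun y hy => ?_)
    have h1 := (hdiff _ y (abs_nonneg ρ) hy).2
    have h2 := h.weightPrim_le ((abs_nonneg ρ).trans hy)
    have h3 : weightPrim β C |ρ| = C ^ 2 / (2 * β - 2) -
      C ^ 2 / (2 * β - 2) * (1 + |ρ|) ^ (2 - 2 * β) := by unfold weightPrim; ring
    linarith
  have hg : truncProfile τ m = fun t => τ (t * Real.exp (m t)) := by
    ext t
    rw [truncProfile, max_eq_left (hm0 t)]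
  have hgeven : ∀ t, truncProfile τ m (-t) = truncProfile τ m t := fun t => by
    rw [hg]
    simp only
    rw [hmeven, neg_mul, hτ]
  set κ := radAvg d (truncProfile τ m) with hκ
  have hκeven : ∀ t, κ (-t) = κ t := radAvg_even d hgeven
  have hκc : Continuous κ := continuous_radAvg d (h.continuous_truncProfile hmc)
  have hm' : ∀ ρ, m ρ = a - ∫ s in (0 : ℝ)..ρ, eta s (κ s) := fun ρ => by
    rcases le_total 0 ρ with hρ | hρ
    · rw [hm, abs_of_nonneg hρ]
      rfl
    · rw [hm, abs_of_nonpos hρ]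
      congr 1
      have h1 := intervalIntegral.integral_comp_neg (a := 0) (b := ρ) (fun s => eta s (κ s))
      simp only [hκeven, eta_neg, intervalIntegral.integral_neg, neg_zero] at h1
      change ∫ s in (0 : ℝ)..(-ρ), eta s (κ s) = _
      rw [intervalIntegral.integral_symm, ← h1, neg_neg]
  have hηc : Continuous fun s => eta s (κ s) := continuous_eta hκc
  have hmd : ∀ ρ, HasDerivAt m (-eta ρ (κ ρ)) ρ := fun ρ => by
    rw [show m = fun ρ => a - ∫ s in (0 : ℝ)..ρ, eta s (κ s) from funext hm']
    exact (intervalIntegral.integral_hasDerivAt_right (hηc.intervalIntegrable _ _)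
      (hηc.stronglyMeasurableAtFilter _ _) hηc.continuousAt).const_sub a
  set g' : ℝ → ℝ := fun t => τ' (t * Real.exp (m t)) *
    (Real.exp (m t) + t * (Real.exp (m t) * -eta t (κ t))) with hg'
  have hgd : ∀ t, HasDerivAt (truncProfile τ m) (g' t) t := fun t => by
    rw [hg]
    refine ((h.hasDerivAt _).comp t ((hasDerivAt_id t).mul (hmd t).exp)).congr_deriv ?_
    simp [hg']
  have hgc : Continuous g' := by
    have := h.continuous_deriv
    fun_prop
  refine ⟨m, κ, radAvg (d + 1) g', hmd, hasDerivAt_radAvg d hgd hgc, continuous_radAvg _ hgc, ?_,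
    fun ρ => ?_, hm0, hmB, fun ρ => ?_⟩
  · simp [radAvg, deriv_zero_of_even hgd hgeven]
  · rw [mul_radAvg_succ d hgd hgc, ← hκ, hg]
  · have : κ ρ = κ |ρ| := by
      rcases abs_choice ρ with h1 | h1 <;> rw [h1]
      rw [hκeven]
    rw [this]
    exact h.abs_radAvg_truncProfile_le m (abs_nonneg ρ)

theorem exists_radialSolution (h : DecayProfile d β C τ τ') (hτ : ∀ s, τ (-s) = τ s) :
    ∃ (B : ℝ) (μ k k' : ℝ → ℝ), RadialSolution d β B τ μ k k' := by
  obtain ⟨m, κ, κ', hm, hκ, hκc, hκ0, hκκ, hm0, hmB, hκB⟩ := h.exists_areal hτ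
  set M := C ^ 2 / (2 * β - 2) with hM
  have hMpos : 0 < M := h.const_pos
  have hβ := h.one_lt
  have hC := h.pos
  have hmM : ∀ ρ, m ρ ≤ M := fun ρ => (hmB ρ).trans <| mul_le_of_le_one_right hMpos.le <|
    Real.rpow_le_one_of_one_le_of_nonpos (by linarith [abs_nonneg ρ]) (by linarith)
  set u : ℝ → ℝ := fun ρ => ρ * Real.exp (m ρ) with hu
  have hud : ∀ ρ, HasDerivAt u (Real.exp (m ρ) / lor (ρ * κ ρ)) ρ := fun ρ => by
    refine ((hasDerivAt_id ρ).mul (hm ρ).exp).congr_deriv ?_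
    have h1 := lor_pos (ρ * κ ρ)
    have h2 := lor_sq (ρ * κ ρ)
    simp only [id, eta]
    field_simp
    linear_combination h2
  have hmono : StrictMono u := strictMono_of_hasDerivAt_pos hud fun ρ =>
    div_pos (Real.exp_pos _) (lor_pos _)
  have huc : Continuous u := continuous_iff_continuousAt.2 fun t => (hud t).continuousAt
  have hsurj : Function.Surjective u := by
    refine huc.surjective ?_ ?_
    · refine tendsto_atTop_mono' _ ((eventually_ge_atTop 0).mono fun x hx => ?_) tendsto_id
      exact le_mul_of_one_le_right hx (Real.one_le_exp (hm0 x))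
    · refine tendsto_atBot_mono' _ ((eventually_le_atBot 0).mono fun x hx => ?_) tendsto_id
      have := Real.one_le_exp (hm0 x)
      simp only [hu, id]
      nlinarith
  let e := hmono.orderIsoOfSurjective u hsurj
  set R : ℝ → ℝ := fun r => e.symm r with hR
  have huR : ∀ r, u (R r) = r := fun r => e.apply_symm_apply r
  have hRc : Continuous R := e.symm.continuous
  have hRd : ∀ r, HasDerivAt R (Real.exp (m (R r)) / lor (R r * κ (R r)))⁻¹ r := fun r =>
    (hud (R r)).of_local_left_inverse hRc.continuousAt
      (div_pos (Real.exp_pos _) (lor_pos _)).ne' (Eventually.of_forall huR)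
  have hRr : ∀ r, r * Real.exp (-m (R r)) = R r := fun r => by
    rw [Real.exp_neg, mul_inv_eq_iff_eq_mul₀ (Real.exp_ne_zero _)]
    exact (huR r).symm
  have hR0 : R 0 = 0 := by
    have := hRr 0
    rw [zero_mul] at this
    exact this.symm
  have hcomp : ∀ γ, 0 ≤ γ → ∀ r, (1 + |R r|) ^ (-γ) ≤ Real.exp (M * γ) * (1 + |r|) ^ (-γ) := by
    intro γ hγ r
    have h1 : Real.exp (-M) * (1 + |r|) ≤ 1 + |R r| := by
      have h2 : Real.exp (-M) ≤ Real.exp (-m (R r)) := Real.exp_le_exp.2 (by linarith [hmM (R r)])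
      have h3 : Real.exp (-M) ≤ 1 := Real.exp_le_one_iff.2 (by linarith)
      have h4 : |R r| = |r| * Real.exp (-m (R r)) := by
        conv_lhs => rw [← hRr r]
        rw [abs_mul, abs_of_pos (Real.exp_pos _)]
      rw [h4]
      nlinarith [abs_nonneg r]
    calc (1 + |R r|) ^ (-γ) ≤ (Real.exp (-M) * (1 + |r|)) ^ (-γ) :=
          Real.rpow_le_rpow_of_nonpos (by positivity) h1 (by linarith)
      _ = _ := by
          rw [Real.mul_rpow (by positivity) (by positivity), ← Real.exp_mul]
          ring_nf
  have hE : ∀ r, lor (r * Real.exp (-m (R r)) * κ (R r)) = lor (R r * κ (R r)) := fun r => by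
    rw [hRr]
  set B := M * Real.exp (M * (2 * β - 2)) + C * Real.exp (M * β) with hB
  refine ⟨B, fun r => m (R r), fun r => κ (R r),
    fun r => κ' (R r) * (Real.exp (m (R r)) / lor (R r * κ (R r)))⁻¹, fun r => ?_,
    fun r => (hκ _).comp r (hRd r), ?_, ?_, fun r => ?_, fun r => hm0 _, fun r => ?_, fun r => ?_,
    by positivity⟩
  · refine ((hm _).comp r (hRd r)).congr_deriv ?_
    rw [hE]
    have h1 := lor_pos (R r * κ (R r))
    have h2 : r = R r * Real.exp (m (R r)) := (huR r).symm
    have h3 : r * Real.exp (-2 * m (R r)) = R r * (Real.exp (m (R r)))⁻¹ := by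
      conv_lhs => rw [h2]
      rw [show R (R r * Real.exp (m (R r))) = R r by rw [← h2], mul_assoc, ← Real.exp_add,
        ← Real.exp_neg]
      ring_nf
    rw [h3, eta]
    field_simp
  · have h1 : Continuous m := continuous_iff_continuousAt.2 fun t => (hm t).continuousAt
    have h2 : Continuous κ := continuous_iff_continuousAt.2 fun t => (hκ t).continuousAt
    have h3 := continuous_lor
    refine (hκc.comp hRc).mul (Continuous.inv₀ (Continuous.div (by fun_prop) (by fun_prop)
      fun r => (lor_pos _).ne') fun r => (div_pos (Real.exp_pos _) (lor_pos _)).ne')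
  · simp [hR0, hκ0]
  · have h1 := lor_pos (R r * κ (R r))
    have h3 : r = R r * Real.exp (m (R r)) := (huR r).symm
    have h4 : τ r = τ (R r * Real.exp (m (R r))) := congrArg τ h3
    have h5 : ∀ y, r * y = R r * Real.exp (m (R r)) * y := fun y => congrArg (· * y) h3
    rw [hE, h4, ← hκκ, h5]
    field_simp
  · refine (hmB _).trans ?_
    have h1 := hcomp (2 * β - 2) (by linarith) r
    rw [neg_sub] at h1
    calc _ ≤ M * (Real.exp (M * (2 * β - 2)) * (1 + |r|) ^ (2 - 2 * β)) := by gcongr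
      _ = (M * Real.exp (M * (2 * β - 2))) * (1 + |r|) ^ (2 - 2 * β) := by ring
      _ ≤ _ := by
        gcongr
        rw [hB]
        linarith [mul_pos hC (Real.exp_pos (M * β))]
  · refine (hκB _).trans ?_
    have h1 := hcomp β (by linarith) r
    calc _ ≤ C * (Real.exp (M * β) * (1 + |r|) ^ (-β)) := by gcongr
      _ = (C * Real.exp (M * β)) * (1 + |r|) ^ (-β) := by ring
      _ ≤ _ := by
        gcongr
        rw [hB]
        linarith [mul_pos hMpos (Real.exp_pos (M * (2 * β - 2)))]

end DecayProfile

theorem div_mul_le_self_of_nonneg {a : ℝ} (ha : 0 ≤ a) (b : ℝ) : a / b * b ≤ a := by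
  rcases eq_or_ne b 0 with rfl | hb
  · simpa using ha
  · rw [div_mul_cancel₀ a hb]

section RadialCalculus

variable {E F : Type*} [NormedAddCommGroup E] [InnerProductSpace ℝ E] [NormedAddCommGroup F]
  [NormedSpace ℝ F]

theorem hasFDerivAt_comp_norm_of_ne {h : ℝ → ℝ} {h' : ℝ} {x : E} (hx : x ≠ 0)
    (hh : HasDerivAt h h' ‖x‖) :
    HasFDerivAt (fun y : E => h ‖y‖) ((h' / ‖x‖) • innerSL ℝ x) x := by
  have hx' : 0 < ‖x‖ := norm_pos_iff.2 hx
  have h1 := (hasStrictFDerivAt_norm_sq x).hasFDerivAt.sqrt (by positivity)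
  simp only [Real.sqrt_sq (norm_nonneg _)] at h1
  refine (hh.comp_hasFDerivAt x h1).congr_fderiv ?_
  ext v
  simp
  field_simp

theorem hasFDerivAt_comp_norm {h h' : ℝ → ℝ} (hh : ∀ r, HasDerivAt h (h' r) r) (h0 : h' 0 = 0)
    (x : E) : HasFDerivAt (fun y : E => h ‖y‖) ((h' ‖x‖ / ‖x‖) • innerSL ℝ x) x := by
  rcases eq_or_ne x 0 with rfl | hx
  · have h1 : (fun r => h r - h 0) =o[nhds 0] fun r : ℝ => r := by
      simpa [h0] using (hasDerivAt_iff_isLittleO.1 (hh 0))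
    have h2 := h1.comp_tendsto (tendsto_norm_zero (E := E))
    refine HasFDerivAt.of_isLittleO ?_
    simpa [Function.comp_def] using Asymptotics.isLittleO_norm_right.1 h2
  · exact hasFDerivAt_comp_norm_of_ne hx (hh _)

theorem contDiff_one_comp_norm {h h' : ℝ → ℝ} (hh : ∀ r, HasDerivAt h (h' r) r)
    (hc : Continuous h') (h0 : h' 0 = 0) : ContDiff ℝ 1 (fun x : E => h ‖x‖) := by
  rw [contDiff_one_iff_fderiv]
  refine ⟨fun x => (hasFDerivAt_comp_norm hh h0 x).differentiableAt, ?_⟩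
  rw [funext fun x : E => (hasFDerivAt_comp_norm hh h0 x).fderiv]
  refine continuous_iff_continuousAt.2 fun x => ?_
  rcases eq_or_ne x 0 with rfl | hx
  · have h1 : Tendsto (fun x : E => |h' ‖x‖|) (nhds 0) (nhds 0) := by
      have : Continuous fun x : E => |h' ‖x‖| := by fun_prop
      simpa [h0] using this.tendsto 0
    simp only [ContinuousAt, map_zero, smul_zero]
    refine squeeze_zero_norm (fun y => ?_) h1
    rw [norm_smul, innerSL_apply_norm, norm_div, norm_norm, Real.norm_eq_abs]
    exact div_mul_le_self_of_nonneg (abs_nonneg _) _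
  · have : ‖x‖ ≠ 0 := norm_ne_zero_iff.2 hx
    exact ((hc.comp continuous_norm).continuousAt.div continuous_norm.continuousAt this).smul
      (innerSL ℝ).continuous.continuousAt

theorem hasFDerivAt_bilin_diag (B : E →L[ℝ] E →L[ℝ] F) (x : E) :
    HasFDerivAt (fun y => B y y) (B x + B.flip x) x := by
  refine (B.hasFDerivAt_of_bilinear (hasFDerivAt_id x) (hasFDerivAt_id x)).congr_fderiv ?_
  ext v
  simp

/-- A homogeneous function of degree `0` times a radial `C¹` function vanishing to first order at
the origin is `C¹`. -/
theorem contDiff_one_radial_smul_bilin (B : E →L[ℝ] E →L[ℝ] F) {q q' : ℝ → ℝ}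
    (hq : ∀ r, HasDerivAt q (q' r) r) (hc : Continuous q') (h0 : q 0 = 0) (h0' : q' 0 = 0) :
    ContDiff ℝ 1 (fun x : E => (q ‖x‖ / ‖x‖ ^ 2) • B x x) := by
  have hqo : (fun r => q r) =o[nhds 0] fun r : ℝ => r := by
    simpa [h0, h0'] using (hasDerivAt_iff_isLittleO.1 (hq 0))
  have hqc : Continuous q := continuous_iff_continuousAt.2 fun r => (hq r).continuousAt
  set G' : E → E →L[ℝ] F := fun x => (q ‖x‖ / ‖x‖ ^ 2) • (B x + B.flip x) +
    (((q' ‖x‖ / ‖x‖ ^ 2 - 2 * q ‖x‖ / ‖x‖ ^ 3) / ‖x‖) • innerSL ℝ x).smulRight (B x x) with hG'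
  have hB : ∀ x, ‖B x x‖ ≤ ‖B‖ * ‖x‖ ^ 2 := fun x => by
    rw [pow_two, ← mul_assoc]
    exact B.le_opNorm₂ x x
  have hder : ∀ x, HasFDerivAt (fun x : E => (q ‖x‖ / ‖x‖ ^ 2) • B x x) (G' x) x := by
    intro x
    rcases eq_or_ne x 0 with rfl | hx
    · refine HasFDerivAt.of_isLittleO ?_
      have h2 := hqo.comp_tendsto (tendsto_norm_zero (E := E))
      have h3 : (fun x : E => (q ‖x‖ / ‖x‖ ^ 2) • B x x) =O[nhds 0] fun x : E => q ‖x‖ := by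
        refine Asymptotics.IsBigO.of_bound ‖B‖ (Eventually.of_forall fun x => ?_)
        rw [norm_smul, norm_div, norm_pow, norm_norm]
        calc _ ≤ ‖q ‖x‖‖ / ‖x‖ ^ 2 * (‖B‖ * ‖x‖ ^ 2) := by gcongr; exact hB x
          _ ≤ ‖q ‖x‖‖ * ‖B‖ := by
            rw [mul_comm ‖B‖, ← mul_assoc]
            gcongr
            exact div_mul_le_self_of_nonneg (norm_nonneg _) _
          _ = _ := mul_comm _ _
      simpa [hG', h0] using Asymptotics.isLittleO_norm_right.1 (h3.trans_isLittleO h2)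
    · have hr : ‖x‖ ≠ 0 := norm_ne_zero_iff.2 hx
      have h1 : HasDerivAt (fun r => q r / r ^ 2) (q' ‖x‖ / ‖x‖ ^ 2 - 2 * q ‖x‖ / ‖x‖ ^ 3) ‖x‖ := by
        refine ((hq ‖x‖).div (hasDerivAt_pow 2 ‖x‖) (by positivity)).congr_deriv ?_
        field_simp
        push_cast
        ring
      exact (hasFDerivAt_comp_norm_of_ne hx h1).smul (hasFDerivAt_bilin_diag B x)
  rw [contDiff_one_iff_fderiv]
  refine ⟨fun x => (hder x).differentiableAt, ?_⟩
  rw [funext fun x : E => (hder x).fderiv]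
  refine continuous_iff_continuousAt.2 fun x => ?_
  rcases eq_or_ne x 0 with rfl | hx
  · have h1 : Tendsto (fun x : E => ‖B‖ * (|q' ‖x‖| + 4 * |q ‖x‖ / ‖x‖|)) (nhds 0) (nhds 0) := by
      have h2 : Tendsto (fun x : E => |q' ‖x‖|) (nhds 0) (nhds 0) := by
        have : Continuous fun x : E => |q' ‖x‖| := by fun_prop
        simpa [h0'] using this.tendsto 0
      have h3 := (hqo.tendsto_div_nhds_zero.comp (tendsto_norm_zero (E := E))).abs
      simpa using (h2.add (h3.const_mul 4)).const_mul ‖B‖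
    have h2 : G' 0 = 0 := by simp [hG']
    rw [ContinuousAt, h2]
    refine squeeze_zero_norm (fun y => ?_) h1
    rcases eq_or_ne y 0 with rfl | hy
    · rw [h2, norm_zero]
      positivity
    have hr : 0 < ‖y‖ := norm_pos_iff.2 hy
    have e1 : ‖B y + B.flip y‖ ≤ 2 * (‖B‖ * ‖y‖) := by
      refine (norm_add_le _ _).trans ?_
      have a1 := B.le_opNorm y
      have a2 := B.flip.le_opNorm y
      rw [B.opNorm_flip] at a2
      linarith
    have e2 : |q' ‖y‖ / ‖y‖ ^ 2 - 2 * q ‖y‖ / ‖y‖ ^ 3|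
        ≤ |q' ‖y‖| / ‖y‖ ^ 2 + 2 * |q ‖y‖| / ‖y‖ ^ 3 := by
      refine (abs_sub _ _).trans (le_of_eq ?_)
      rw [abs_div, abs_div, abs_mul, abs_of_pos (pow_pos hr 2), abs_of_pos (pow_pos hr 3), abs_two]
    refine (norm_add_le _ _).trans ?_
    rw [norm_smul, ContinuousLinearMap.norm_smulRight_apply, norm_smul, innerSL_apply_norm,
      norm_div, norm_div, norm_pow, norm_norm, Real.norm_eq_abs, Real.norm_eq_abs,
      div_mul_cancel₀ _ hr.ne', abs_div,
      abs_of_pos hr]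
    calc _ ≤ |q ‖y‖| / ‖y‖ ^ 2 * (2 * (‖B‖ * ‖y‖)) +
          (|q' ‖y‖| / ‖y‖ ^ 2 + 2 * |q ‖y‖| / ‖y‖ ^ 3) * (‖B‖ * ‖y‖ ^ 2) := by
          gcongr
          exact hB y
      _ = _ := by
          field_simp
          ring
  · have hr : ‖x‖ ≠ 0 := norm_ne_zero_iff.2 hx
    have h1 : ContinuousAt (fun x : E => q ‖x‖) x := by fun_prop
    have h2 : ContinuousAt (fun x : E => q' ‖x‖) x := by fun_prop
    have h3 : ContinuousAt (fun x : E => ‖x‖) x := continuous_norm.continuousAt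
    have h4 : ContinuousAt (fun x : E => B x + B.flip x) x := by fun_prop
    have h5 : ContinuousAt (fun x : E => B x x) x := by fun_prop
    have h6 : ContinuousAt (fun x : E => innerSL ℝ x) x := (innerSL ℝ).continuous.continuousAt
    refine ((h1.div (h3.pow 2) (pow_ne_zero 2 hr)).smul h4).add ?_
    have h7 := (((h2.div (h3.pow 2) (pow_ne_zero 2 hr)).sub ((h1.const_mul 2).div (h3.pow 3)
      (pow_ne_zero 3 hr))).div h3 hr).smul h6
    exact ((ContinuousLinearMap.smulRightL ℝ E F).continuous₂.continuousAt).comp (h7.prodMk h5)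

/-- The profile `f` of a `C²` radial vector field `x ↦ f(|x|) x`, together with `y(r) = r f'(r)`
and the derivatives of both. -/
structure RadialField (f f' y y' : ℝ → ℝ) : Prop where
  hasDerivAt : ∀ r, HasDerivAt f (f' r) r
  continuous_deriv : Continuous f'
  deriv_zero : f' 0 = 0
  mul_deriv : ∀ r, r * f' r = y r
  hasDerivAt_aux : ∀ r, HasDerivAt y (y' r) r
  continuous_aux : Continuous y'
  aux_zero : y' 0 = 0

/-- The derivative of the radial vector field `x ↦ f(|x|) x`, where `y(r) = r f'(r)`. -/
def radialFieldDeriv (f y : ℝ → ℝ) (x : E) : E →L[ℝ] E :=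
  f ‖x‖ • ContinuousLinearMap.id ℝ E + (y ‖x‖ / ‖x‖ ^ 2) • (innerSL ℝ x).smulRight x

namespace RadialField

variable {f f' y y' : ℝ → ℝ}

theorem hasFDerivAt (h : RadialField f f' y y') (x : E) :
    HasFDerivAt (fun x : E => f ‖x‖ • x) (radialFieldDeriv f y x) x := by
  refine ((hasFDerivAt_comp_norm h.hasDerivAt h.deriv_zero x).smul
    (hasFDerivAt_id x)).congr_fderiv ?_
  ext v
  rw [radialFieldDeriv, ← h.mul_deriv]
  rcases eq_or_ne x 0 with rfl | hx
  · simp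
  have hr : ‖x‖ ≠ 0 := norm_ne_zero_iff.2 hx
  simp [smul_smul]
  congr 1
  field_simp

theorem contDiff_one_deriv (h : RadialField f f' y y') :
    ContDiff ℝ 1 (radialFieldDeriv (E := E) f y) := by
  have h1 := contDiff_one_radial_smul_bilin
    ((ContinuousLinearMap.smulRightL ℝ E E).comp (innerSL ℝ)) h.hasDerivAt_aux h.continuous_aux
    (by simp [← h.mul_deriv]) h.aux_zero
  exact ((contDiff_one_comp_norm h.hasDerivAt h.continuous_deriv h.deriv_zero).smul
    contDiff_const).add h1

theorem contDiff_two (h : RadialField f f' y y') : ContDiff ℝ 2 (fun x : E => f ‖x‖ • x) := by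
  rw [show (2 : WithTop ℕ∞) = 1 + 1 by norm_num, contDiff_succ_iff_fderiv]
  refine ⟨fun x => (h.hasFDerivAt x).differentiableAt, by simp, ?_⟩
  rw [funext fun x : E => (h.hasFDerivAt x).fderiv]
  exact h.contDiff_one_deriv

theorem norm_radialFieldDeriv_le (f y : ℝ → ℝ) (x : E) :
    ‖radialFieldDeriv f y x‖ ≤ |f ‖x‖| + |y ‖x‖| := by
  refine (norm_add_le _ _).trans (add_le_add ?_ ?_)
  · rw [norm_smul, Real.norm_eq_abs]
    exact mul_le_of_le_one_right (abs_nonneg _) ContinuousLinearMap.norm_id_le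
  · rw [norm_smul, ContinuousLinearMap.norm_smulRight_apply, innerSL_apply_norm, norm_div, norm_pow,
      norm_norm, Real.norm_eq_abs, ← pow_two]
    exact div_mul_le_self_of_nonneg (abs_nonneg _) _

end RadialField

end RadialCalculus

/-- The Lorentz factor of the slice. -/
def tilt (μ k : ℝ → ℝ) (r : ℝ) : ℝ := lor (r * Real.exp (-μ r) * k r)

/-- The profile `p` of the gradient `p(|x|) x` of the conformal factor. -/
def gradProfile (d : ℕ) (μ k : ℝ → ℝ) (r : ℝ) : ℝ :=
  ((d : ℝ) - 1) / 2 * (Real.exp (-(((d : ℝ) + 3) / 2 * μ r)) * (k r ^ 2 / (1 + tilt μ k r)))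

/-- The Laplacian of the conformal factor. -/
def lapProfile (d : ℕ) (τ μ k : ℝ → ℝ) (r : ℝ) : ℝ :=
  ((d : ℝ) - 1) / 2 * (Real.exp (-(((d : ℝ) + 3) / 2 * μ r)) *
    (k r * τ r - ((d : ℝ) + 1) / 2 * k r ^ 2))

/-- The profile of the trace-free part of `k`, up to normalisation. -/
def shearProfile (d : ℕ) (τ μ k : ℝ → ℝ) (r : ℝ) : ℝ :=
  1 / 2 * (Real.exp (-(((d : ℝ) + 1) * μ r)) * (τ r - ((d : ℝ) + 1) * k r))

theorem tilt_pos (μ k : ℝ → ℝ) (r : ℝ) : 0 < tilt μ k r := lor_pos _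

theorem tilt_sq (μ k : ℝ → ℝ) (r : ℝ) :
    tilt μ k r ^ 2 = 1 + (r * Real.exp (-μ r) * k r) ^ 2 := lor_sq _

namespace RadialSolution

variable {d : ℕ} {β B : ℝ} {τ τ' μ k k' : ℝ → ℝ}

theorem exists_deriv_mu (h : RadialSolution d β B τ μ k k') :
    ∃ m' : ℝ → ℝ, (∀ r, HasDerivAt μ (m' r) r) ∧ Continuous m' ∧ m' 0 = 0 ∧
      (∀ r, r * m' r = 1 - tilt μ k r) ∧
      ∀ r, m' r = -(r * (Real.exp (-(2 * μ r)) * (k r ^ 2 / (1 + tilt μ k r)))) := by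
  have hμ : Continuous μ :=
    continuous_iff_continuousAt.2 fun r => (h.hasDerivAt_mu r).continuousAt
  have hk : Continuous k := continuous_iff_continuousAt.2 fun r => (h.hasDerivAt_k r).continuousAt
  refine ⟨_, h.hasDerivAt_mu, ?_, by simp, fun r => ?_, fun r => ?_⟩
  · have h1 : Continuous fun r => 1 + lor (r * Real.exp (-μ r) * k r) :=
      continuous_const.add (continuous_lor.comp (by fun_prop))
    exact (Continuous.div (by fun_prop) h1 fun r => by
      linarith [lor_pos (r * exp (-μ r) * k r)]).neg
  · have h1 := tilt_sq μ k r
    have h2 := tilt_pos μ k r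
    change r * -(r * Real.exp (-2 * μ r) * k r ^ 2 / (1 + tilt μ k r)) = _
    rw [show -2 * μ r = -μ r + -μ r by ring, Real.exp_add]
    field_simp
    nlinarith
  · change -(r * Real.exp (-2 * μ r) * k r ^ 2 / (1 + tilt μ k r)) = _
    rw [neg_mul]
    ring

theorem mul_deriv_k_eq (h : RadialSolution d β B τ μ k k') (r : ℝ) :
    r * k' r = tilt μ k r * (τ r - (d + 1) * k r) := h.mul_deriv_k r

theorem exists_deriv_tilt (h : RadialSolution d β B τ μ k k') :
    ∃ e' : ℝ → ℝ, (∀ r, HasDerivAt (tilt μ k) (e' r) r) ∧ Continuous e' ∧ e' 0 = 0 ∧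
      ∀ r, k r * (r * e' r) = (tilt μ k r ^ 2 - 1) * (k r + τ r - (d + 1) * k r) := by
  obtain ⟨m', hm, hmc, hm0, hrm, -⟩ := h.exists_deriv_mu
  have hμ : Continuous μ := continuous_iff_continuousAt.2 fun r => (hm r).continuousAt
  have hk : Continuous k := continuous_iff_continuousAt.2 fun r => (h.hasDerivAt_k r).continuousAt
  have hk' := h.continuous_deriv_k
  have hu : ∀ r, HasDerivAt (fun r => r * Real.exp (-μ r) * k r)
      (Real.exp (-μ r) * (k r - r * m' r * k r + r * k' r)) r := fun r => by
    refine (((hasDerivAt_id r).mul (hm r).neg.exp).mul (h.hasDerivAt_k r)).congr_deriv ?_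
    simp
    ring
  have he : ∀ r, HasDerivAt (tilt μ k) _ r := fun r => (hasDerivAt_lor _).comp r (hu r)
  refine ⟨_, he, ?_, by simp, fun r => ?_⟩
  · refine Continuous.mul (Continuous.div (by fun_prop) ?_ fun r => (lor_pos _).ne') (by fun_prop)
    exact continuous_lor.comp (by fun_prop)
  · have h1 := tilt_sq μ k r
    have h2 := tilt_pos μ k r
    change k r * (r * (r * Real.exp (-μ r) * k r / tilt μ k r * _)) = _
    rw [hrm, h.mul_deriv_k_eq, h1]
    field_simp
    ring

theorem exists_radialField_grad (h : RadialSolution d β B τ μ k k')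
    (hτ : ∀ r, HasDerivAt τ (τ' r) r) (hτc : Continuous τ') (hτ0 : τ' 0 = 0) :
    ∃ p' q', RadialField (gradProfile d μ k) p'
      (fun r => lapProfile d τ μ k r - (d + 1) * gradProfile d μ k r) q' := by
  obtain ⟨m', hm, hmc, hm0, hrm, -⟩ := h.exists_deriv_mu
  obtain ⟨e', he, hec, he0, hre⟩ := h.exists_deriv_tilt
  have hk := h.hasDerivAt_k
  have hμC : Continuous μ := continuous_iff_continuousAt.2 fun r => (hm r).continuousAt
  have heC : Continuous (tilt μ k) := continuous_iff_continuousAt.2 fun r => (he r).continuousAt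
  have hkC : Continuous k := continuous_iff_continuousAt.2 fun r => (hk r).continuousAt
  have hτC : Continuous τ := continuous_iff_continuousAt.2 fun r => (hτ r).continuousAt
  have hkc := h.continuous_deriv_k
  have hk0 := h.deriv_k_zero
  have hpos : ∀ r, 1 + tilt μ k r ≠ 0 := fun r => by linarith [tilt_pos μ k r]
  have hx : ∀ r, HasDerivAt (fun r => Real.exp (-(((d : ℝ) + 3) / 2 * μ r)))
      (Real.exp (-(((d : ℝ) + 3) / 2 * μ r)) * -(((d : ℝ) + 3) / 2 * m' r)) r :=
    fun r => ((hm r).const_mul _).neg.exp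
  have hp : ∀ r, HasDerivAt (gradProfile d μ k) _ r := fun r =>
    ((hx r).mul (((hk r).pow 2).div ((he r).const_add 1) (hpos r))).const_mul (((d : ℝ) - 1) / 2)
  have hF : ∀ r, HasDerivAt (lapProfile d τ μ k) _ r := fun r =>
    ((hx r).mul (((hk r).mul (hτ r)).sub (((hk r).pow 2).const_mul (((d : ℝ) + 1) / 2)))).const_mul
      (((d : ℝ) - 1) / 2)
  refine ⟨_, _, hp, ?_, ?_, fun r => ?_, fun r => (hF r).sub ((hp r).const_mul ((d : ℝ) + 1)),
    ?_, ?_⟩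
  · simp only [Pi.pow_apply, Pi.div_apply]
    fun_prop (disch := simp [hpos])
  · simp [hm0, hk0, he0]
  · have h1 := hpos r
    have h2 : r * k' r = _ := h.mul_deriv_k_eq r
    simp only [lapProfile, gradProfile, Pi.pow_apply, Pi.div_apply]
    calc _ = ((d : ℝ) - 1) / 2 * (Real.exp (-(((d : ℝ) + 3) / 2 * μ r)) *
          (-(((d : ℝ) + 3) / 2 * (r * m' r)) * (k r ^ 2 / (1 + tilt μ k r)) +
            (2 * k r * (r * k' r) * (1 + tilt μ k r) - k r * (k r * (r * e' r))) /
              (1 + tilt μ k r) ^ 2)) := by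
          push_cast
          ring
      _ = _ := by
          rw [hrm, h2, hre]
          field_simp
          ring
  · simp only [Pi.pow_apply, Pi.div_apply, Pi.mul_apply, Pi.sub_apply]
    fun_prop (disch := simp [hpos])
  · simp [hm0, hk0, he0, hτ0]

theorem exists_radialField_shear (h : RadialSolution d β B τ μ k k')
    (hτ : ∀ r, HasDerivAt τ (τ' r) r) (hτc : Continuous τ') (hτ0 : τ' 0 = 0) :
    ∃ f f' y', RadialField f f' (shearProfile d τ μ k) y' ∧
      ∀ r, (d + 1) * f' r + y' r = 1 / 2 * (Real.exp (-(((d : ℝ) + 1) * μ r)) * τ' r) := by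
  obtain ⟨m', hm, hmc, hm0, hrm, -⟩ := h.exists_deriv_mu
  obtain ⟨e', he, -⟩ := h.exists_deriv_tilt
  have hk := h.hasDerivAt_k
  have hμC : Continuous μ := continuous_iff_continuousAt.2 fun r => (hm r).continuousAt
  have heC : Continuous (tilt μ k) := continuous_iff_continuousAt.2 fun r => (he r).continuousAt
  have hkC : Continuous k := continuous_iff_continuousAt.2 fun r => (hk r).continuousAt
  have hτC : Continuous τ := continuous_iff_continuousAt.2 fun r => (hτ r).continuousAt
  have hkc := h.continuous_deriv_k
  have hk0 := h.deriv_k_zero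
  have hpos : ∀ r, tilt μ k r ≠ 0 := fun r => (tilt_pos μ k r).ne'
  have hx : ∀ r, HasDerivAt (fun r => Real.exp (-(((d : ℝ) + 1) * μ r)))
      (Real.exp (-(((d : ℝ) + 1) * μ r)) * -(((d : ℝ) + 1) * m' r)) r :=
    fun r => ((hm r).const_mul _).neg.exp
  have hy : ∀ r, HasDerivAt (shearProfile d τ μ k) _ r := fun r =>
    ((hx r).mul ((hτ r).sub ((hk r).const_mul ((d : ℝ) + 1)))).const_mul (1 / 2)
  set f' : ℝ → ℝ := fun r => 1 / 2 * (Real.exp (-(((d : ℝ) + 1) * μ r)) * (k' r / tilt μ k r))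
    with hf'
  have hfc : Continuous f' := by fun_prop (disch := simp [hpos])
  refine ⟨fun r => ∫ s in (0 : ℝ)..r, f' s, f', _, ⟨fun r => ?_, hfc, ?_, fun r => ?_, hy, ?_, ?_⟩,
    fun r => ?_⟩
  · exact intervalIntegral.integral_hasDerivAt_right (hfc.intervalIntegrable _ _)
      (hfc.stronglyMeasurableAtFilter _ _) hfc.continuousAt
  · simp [hf', hk0]
  · have h1 := hpos r
    rw [hf', shearProfile]
    calc _ = 1 / 2 * (Real.exp (-(((d : ℝ) + 1) * μ r)) * (r * k' r / tilt μ k r)) := by ring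
      _ = _ := by
        rw [h.mul_deriv_k_eq]
        field_simp
  · simp only [Pi.sub_apply]
    fun_prop
  · simp [hm0, hk0, hτ0]
  · simp only [Pi.sub_apply, hf']
    rcases eq_or_ne r 0 with rfl | hr
    · simp [hm0, hk0]
    · have h1 := hpos r
      have h2 : m' r = (1 - tilt μ k r) / r := by rw [← hrm r]; field_simp
      have h3 : τ r - (d + 1) * k r = r * k' r / tilt μ k r := by
        rw [h.mul_deriv_k_eq]
        field_simp
      rw [h2, h3]
      field_simp
      ring

theorem gradProfile_nonneg (hd : 1 ≤ d) (μ k : ℝ → ℝ) (r : ℝ) : 0 ≤ gradProfile d μ k r := by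
  have h1 : (1 : ℝ) ≤ d := by exact_mod_cast hd
  have h2 := tilt_pos μ k r
  have h3 : 0 ≤ ((d : ℝ) - 1) / 2 := by linarith
  unfold gradProfile
  positivity

theorem sq_k_le (h : RadialSolution d β B τ μ k k') (r : ℝ) :
    k r ^ 2 ≤ B ^ 2 * (1 + |r|) ^ (-(2 * β)) := by
  have h1 : 0 < 1 + |r| := by positivity
  calc k r ^ 2 = |k r| ^ 2 := (sq_abs _).symm
    _ ≤ (B * (1 + |r|) ^ (-β)) ^ 2 := pow_le_pow_left₀ (abs_nonneg _) (h.abs_k_le r) 2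
    _ = _ := by
      rw [mul_pow, ← Real.rpow_mul_natCast h1.le]
      congr 2
      push_cast
      ring

theorem exp_neg_mul_mu_le_one (h : RadialSolution d β B τ μ k k') {a : ℝ} (ha : 0 ≤ a) (r : ℝ) :
    Real.exp (-(a * μ r)) ≤ 1 :=
  Real.exp_le_one_iff.2 (neg_nonpos.2 (mul_nonneg ha (h.mu_nonneg r)))

theorem abs_gradProfile_le (h : RadialSolution d β B τ μ k k') (hd : 1 ≤ d) (r : ℝ) :
    |gradProfile d μ k r| ≤ d * B ^ 2 * (1 + |r|) ^ (-(2 * β)) := by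
  have h1 : (1 : ℝ) ≤ d := by exact_mod_cast hd
  rw [abs_of_nonneg (gradProfile_nonneg hd μ k r), gradProfile, mul_assoc (d : ℝ)]
  have h2 := tilt_pos μ k r
  have h3 : k r ^ 2 / (1 + tilt μ k r) ≤ k r ^ 2 :=
    div_le_self (sq_nonneg _) (by linarith)
  have h4 := h.exp_neg_mul_mu_le_one (a := ((d : ℝ) + 3) / 2) (by positivity) r
  refine mul_le_mul (by linarith) ?_ (by positivity) (by positivity)
  refine (mul_le_of_le_one_left (by positivity) h4).trans (h3.trans (h.sq_k_le r))

theorem abs_lapProfile_le (h : RadialSolution d β B τ μ k k') (hd : 1 ≤ d) {C : ℝ}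
    (hτ : ∀ s, |τ s| ≤ C * (1 + |s|) ^ (-β)) (r : ℝ) :
    |lapProfile d τ μ k r| ≤ d * (B * C + (d + 1) * B ^ 2) * (1 + |r|) ^ (-(2 * β)) := by
  have h1 : (1 : ℝ) ≤ d := by exact_mod_cast hd
  have h0 : 0 < 1 + |r| := by positivity
  have h3 : 0 ≤ ((d : ℝ) - 1) / 2 := by linarith
  have h4 := h.exp_neg_mul_mu_le_one (a := ((d : ℝ) + 3) / 2) (by positivity) r
  have h5 : |k r * τ r| ≤ B * C * (1 + |r|) ^ (-(2 * β)) := by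
    rw [abs_mul]
    refine (mul_le_mul (h.abs_k_le r) (hτ r) (abs_nonneg _)
      ((abs_nonneg _).trans (h.abs_k_le r))).trans (le_of_eq ?_)
    rw [show -(2 * β) = -β + -β by ring, Real.rpow_add h0]
    ring
  have h6 := h.sq_k_le r
  have h7 : |k r * τ r - ((d : ℝ) + 1) / 2 * k r ^ 2| ≤
      (B * C + (d + 1) * B ^ 2) * (1 + |r|) ^ (-(2 * β)) := by
    refine (abs_sub _ _).trans ?_
    rw [abs_mul (((d : ℝ) + 1) / 2), abs_of_nonneg (by positivity : 0 ≤ ((d : ℝ) + 1) / 2),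
      abs_of_nonneg (sq_nonneg (k r))]
    have h8 : ((d : ℝ) + 1) / 2 * k r ^ 2 ≤ (d + 1) * (B ^ 2 * (1 + |r|) ^ (-(2 * β))) :=
      mul_le_mul (by linarith) h6 (sq_nonneg _) (by positivity)
    linarith
  rw [lapProfile, abs_mul, abs_mul, abs_of_nonneg h3, Real.abs_exp, mul_assoc (d : ℝ)]
  refine mul_le_mul (by linarith) ?_ (by positivity) (by positivity)
  exact (mul_le_of_le_one_left (abs_nonneg _) h4).trans h7

theorem abs_shearProfile_le (h : RadialSolution d β B τ μ k k') {C : ℝ}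
    (hτ : ∀ s, |τ s| ≤ C * (1 + |s|) ^ (-β)) (r : ℝ) :
    |shearProfile d τ μ k r| ≤ (C + (d + 1) * B) * (1 + |r|) ^ (-β) := by
  have h4 := h.exp_neg_mul_mu_le_one (a := (d : ℝ) + 1) (by positivity) r
  have h7 : |τ r - ((d : ℝ) + 1) * k r| ≤ (C + (d + 1) * B) * (1 + |r|) ^ (-β) := by
    refine (abs_sub _ _).trans ?_
    rw [abs_mul, abs_of_nonneg (by positivity : 0 ≤ (d : ℝ) + 1)]
    have h8 := mul_le_mul_of_nonneg_left (h.abs_k_le r) (by positivity : 0 ≤ (d : ℝ) + 1)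
    linarith [hτ r]
  rw [shearProfile, abs_mul, abs_mul, Real.abs_exp]
  have h9 : Real.exp (-(((d : ℝ) + 1) * μ r)) * |τ r - ((d : ℝ) + 1) * k r| ≤ _ :=
    (mul_le_of_le_one_left (abs_nonneg _) h4).trans h7
  have h10 : |(1 / 2 : ℝ)| ≤ 1 := by norm_num [abs_le]
  exact (mul_le_of_le_one_left (by positivity) h10).trans h9

theorem abs_exp_neg_mul_mu_sub_one_le (h : RadialSolution d β B τ μ k k') {a : ℝ} (ha : 0 ≤ a)
    (r : ℝ) : |Real.exp (-(a * μ r)) - 1| ≤ a * B * (1 + |r|) ^ (2 - 2 * β) := by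
  rw [abs_sub_comm, abs_of_nonneg (sub_nonneg.2 (h.exp_neg_mul_mu_le_one ha r))]
  have h1 := Real.add_one_le_exp (-(a * μ r))
  have h2 := mul_le_mul_of_nonneg_left (h.mu_le r) ha
  linarith

theorem hasDerivAt_conformalFactor (h : RadialSolution d β B τ μ k k') (r : ℝ) :
    HasDerivAt (fun r => Real.exp (-(((d : ℝ) - 1) / 2 * μ r))) (r * gradProfile d μ k r) r := by
  obtain ⟨m', hm, -, -, -, hm'⟩ := h.exists_deriv_mu
  refine ((hm r).const_mul _).neg.exp.congr_deriv ?_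
  change Real.exp (-(((d : ℝ) - 1) / 2 * μ r)) * -(((d : ℝ) - 1) / 2 * m' r) = _
  rw [hm', gradProfile,
    show -(((d : ℝ) + 3) / 2 * μ r) = -(((d : ℝ) - 1) / 2 * μ r) + -(2 * μ r) by ring, Real.exp_add]
  ring

theorem monotoneOn_conformalFactor (h : RadialSolution d β B τ μ k k') (hd : 1 ≤ d) :
    MonotoneOn (fun r => Real.exp (-(((d : ℝ) - 1) / 2 * μ r))) (Set.Ici 0) := by
  refine monotoneOn_of_hasDerivWithinAt_nonneg (convex_Ici 0)
    (fun r _ => (h.hasDerivAt_conformalFactor r).continuousAt.continuousWithinAt)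
    (fun r _ => (h.hasDerivAt_conformalFactor r).hasDerivWithinAt) fun r hr => ?_
  rw [interior_Ici] at hr
  exact mul_nonneg (le_of_lt hr) (gradProfile_nonneg hd μ k r)

end RadialSolution

section Coordinates

variable {n : ℕ}

theorem pd_comp_norm {h h' : ℝ → ℝ} (hh : ∀ r, HasDerivAt h (h' r) r) (h0 : h' 0 = 0)
    (i : Fin n) (x : EuclideanSpace ℝ (Fin n)) :
    pd (fun x => h ‖x‖) i x = h' ‖x‖ / ‖x‖ * x i := by
  rw [pd, (hasFDerivAt_comp_norm hh h0 x).fderiv]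
  simp [EuclideanSpace.inner_single_right]

theorem pd_pd_comm {g : EuclideanSpace ℝ (Fin n) → ℝ} (hg : ContDiff ℝ 2 g) (i j : Fin n)
    (x : EuclideanSpace ℝ (Fin n)) : pd (pd g i) j x = pd (pd g j) i x := by
  have h1 : ∀ i j : Fin n, pd (pd g i) j x =
      fderiv ℝ (fderiv ℝ g) x (EuclideanSpace.single j 1) (EuclideanSpace.single i 1) := by
    intro i j
    have h2 : HasFDerivAt (fderiv ℝ g) _ x :=
      ((hg.fderiv_right (m := 1) (by norm_num)).differentiable (by norm_num) x).hasFDerivAt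
    have h3 := h2.clm_apply (hasFDerivAt_const (EuclideanSpace.single i (1 : ℝ)) x)
    change fderiv ℝ (fun y => fderiv ℝ g y (EuclideanSpace.single i 1)) x _ = _
    rw [h3.fderiv]
    simp
  rw [h1, h1]
  exact (hg.contDiffAt.isSymmSndFDerivAt (by simp)).eq _ _

theorem differentiable_pd {g : EuclideanSpace ℝ (Fin n) → ℝ} (hg : ContDiff ℝ 2 g) (i : Fin n) :
    Differentiable ℝ (pd g i) :=
  ((hg.fderiv_right (m := 1) (by norm_num)).clm_apply contDiff_const).differentiable (by norm_num)

theorem pd_sum {g : Fin n → EuclideanSpace ℝ (Fin n) → ℝ} (hg : ∀ j, Differentiable ℝ (g j))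
    (i : Fin n) (x : EuclideanSpace ℝ (Fin n)) :
    pd (fun y => ∑ j, g j y) i x = ∑ j, pd (g j) i x := by
  rw [pd, (HasFDerivAt.fun_sum fun j _ => (hg j x).hasFDerivAt).fderiv]
  simp [pd]

theorem div_sq_mul_sum_sq {y : ℝ → ℝ} (h0 : y 0 = 0) (x : EuclideanSpace ℝ (Fin n)) :
    y ‖x‖ / ‖x‖ ^ 2 * ‖x‖ ^ 2 = y ‖x‖ := by
  rcases eq_or_ne x 0 with rfl | hx
  · simp [h0]
  · rw [div_mul_cancel₀]
    positivity

namespace RadialField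

variable {f f' y y' : ℝ → ℝ}

theorem aux_at_zero (h : RadialField f f' y y') : y 0 = 0 := by simp [← h.mul_deriv]

theorem contDiff_coord (h : RadialField f f' y y') (j : Fin n) :
    ContDiff ℝ 2 (fun x : EuclideanSpace ℝ (Fin n) => f ‖x‖ * x j) := by
  have h1 := (EuclideanSpace.proj j : EuclideanSpace ℝ (Fin n) →L[ℝ] ℝ).contDiff.comp
    (h.contDiff_two (E := EuclideanSpace ℝ (Fin n)))
  exact h1

theorem pd_coord (h : RadialField f f' y y') (i j : Fin n) (x : EuclideanSpace ℝ (Fin n)) :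
    pd (fun x => f ‖x‖ * x j) i x =
      (if i = j then 1 else 0) * f ‖x‖ + y ‖x‖ / ‖x‖ ^ 2 * (x i * x j) := by
  have h1 : HasFDerivAt (fun x : EuclideanSpace ℝ (Fin n) => f ‖x‖ * x j) _ x :=
    ((EuclideanSpace.proj j : EuclideanSpace ℝ (Fin n) →L[ℝ] ℝ).hasFDerivAt).comp x
      (h.hasFDerivAt x)
  rw [pd, h1.fderiv]
  simp [radialFieldDeriv, EuclideanSpace.inner_single_right, eq_comm (a := i),
    mul_comm]

theorem sum_pd_coord (h : RadialField f f' y y') (x : EuclideanSpace ℝ (Fin n)) :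
    ∑ k, pd (fun x => f ‖x‖ * x k) k x = n * f ‖x‖ + y ‖x‖ := by
  simp_rw [h.pd_coord, if_true, one_mul, Finset.sum_add_distrib, ← Finset.mul_sum, ← pow_two]
  rw [← EuclideanSpace.real_norm_sq_eq, div_sq_mul_sum_sq h.aux_at_zero]
  simp

theorem pd_sum_pd_coord (h : RadialField f f' y y') (i : Fin n) (x : EuclideanSpace ℝ (Fin n)) :
    pd (fun x => ∑ k, pd (fun x => f ‖x‖ * x k) k x) i x =
      (n * f' ‖x‖ + y' ‖x‖) / ‖x‖ * x i := by
  simp_rw [h.sum_pd_coord]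
  exact pd_comp_norm (h := fun r => n * f r + y r) (h' := fun r => n * f' r + y' r)
    (fun r => ((h.hasDerivAt r).const_mul _).add (h.hasDerivAt_aux r))
    (by simp [h.deriv_zero, h.aux_zero]) i x

theorem lap_coord (h : RadialField f f' y y') (i : Fin n) (x : EuclideanSpace ℝ (Fin n)) :
    lap (fun x => f ‖x‖ * x i) x = (n * f' ‖x‖ + y' ‖x‖) / ‖x‖ * x i := by
  rw [← h.pd_sum_pd_coord, pd_sum fun j => differentiable_pd (h.contDiff_coord j) j, lap]
  refine Finset.sum_congr rfl fun j _ => ?_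
  rw [← pd_pd_comm (h.contDiff_coord j)]
  congr 1
  funext z
  rw [h.pd_coord, h.pd_coord, mul_comm (z i), eq_comm]
  simp only [eq_comm]

theorem cK_coord (h : RadialField f f' y y') (i j : Fin n) (x : EuclideanSpace ℝ (Fin n))
    (hn : (n : ℝ) ≠ 0) :
    cK (fun j x => f ‖x‖ * x j) i j x =
      2 * (y ‖x‖ / ‖x‖ ^ 2 * (x i * x j) - (if i = j then 1 else 0) * (y ‖x‖ / n)) := by
  rw [cK, h.sum_pd_coord, h.pd_coord, h.pd_coord]
  simp only [eq_comm (a := j)]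
  field_simp
  ring

theorem sum_sq_cK_coord (h : RadialField f f' y y') (x : EuclideanSpace ℝ (Fin n))
    (hn : (n : ℝ) ≠ 0) :
    ∑ i, ∑ j, cK (fun j x => f ‖x‖ * x j) i j x ^ 2 = 4 * (n - 1) / n * y ‖x‖ ^ 2 := by
  simp_rw [h.cK_coord _ _ x hn]
  set a := y ‖x‖ / ‖x‖ ^ 2 with ha
  have h1 : a * ‖x‖ ^ 2 = y ‖x‖ := div_sq_mul_sum_sq h.aux_at_zero x
  have h2 : ∑ i, x i ^ 2 = ‖x‖ ^ 2 := (EuclideanSpace.real_norm_sq_eq x).symm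
  have h3 : ∀ i j : Fin n, (2 * (a * (x i * x j) - (if i = j then 1 else 0) * (y ‖x‖ / n))) ^ 2 =
      4 * a ^ 2 * x i ^ 2 * x j ^ 2 +
        (if i = j then 4 * (y ‖x‖ / n) ^ 2 - 8 * a * (y ‖x‖ / n) * x i ^ 2 else 0) := by
    intro i j
    split_ifs with hij
    · rw [hij]
      ring
    · ring
  simp_rw [h3, Finset.sum_add_distrib, Finset.sum_ite_eq, Finset.mem_univ, if_true,
    ← Finset.mul_sum, ← Finset.sum_mul, Finset.sum_sub_distrib, ← Finset.mul_sum, h2]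
  simp only [Finset.sum_const, Finset.card_univ, Fintype.card_fin, nsmul_eq_mul]
  calc _ = 4 * (a * ‖x‖ ^ 2) ^ 2 +
      (n * (4 * (y ‖x‖ / n) ^ 2) - 8 * (a * ‖x‖ ^ 2) * (y ‖x‖ / n)) := by ring
    _ = _ := by
      rw [h1]
      field_simp
      ring

theorem abs_cK_coord_le (h : RadialField f f' y y') (i j : Fin n)
    (x : EuclideanSpace ℝ (Fin n)) (hn : 1 ≤ (n : ℝ)) :
    |cK (fun j x => f ‖x‖ * x j) i j x| ≤ 4 * |y ‖x‖| := by
  rw [h.cK_coord i j x (by linarith), abs_mul, abs_two]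
  have h1 : |y ‖x‖ / ‖x‖ ^ 2 * (x i * x j)| ≤ |y ‖x‖| := by
    have h2 : |x i * x j| ≤ ‖x‖ ^ 2 := by
      rw [abs_mul, pow_two]
      exact mul_le_mul (PiLp.norm_apply_le x i) (PiLp.norm_apply_le x j) (abs_nonneg _)
        (norm_nonneg _)
    rw [abs_mul, abs_div, abs_of_nonneg (sq_nonneg ‖x‖)]
    exact (mul_le_mul_of_nonneg_left h2 (by positivity)).trans
      (div_mul_le_self_of_nonneg (abs_nonneg _) _)
  have h3 : |(if i = j then 1 else 0) * (y ‖x‖ / n)| ≤ |y ‖x‖| := by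
    split_ifs
    · rw [one_mul, abs_div, Nat.abs_cast]
      exact div_le_self (abs_nonneg _) hn
    · simp
  linarith [abs_sub (y ‖x‖ / ‖x‖ ^ 2 * (x i * x j)) ((if i = j then 1 else 0) * (y ‖x‖ / n))]

end RadialField

/-! A radial function whose gradient is the radial field `p(|x|) x`. -/

variable {φ p p' q q' : ℝ → ℝ}

theorem fderiv_comp_norm_eq (hφ : ∀ r, HasDerivAt φ (r * p r) r) (x : EuclideanSpace ℝ (Fin n)) :
    fderiv ℝ (fun x : EuclideanSpace ℝ (Fin n) => φ ‖x‖) x = innerSL ℝ (p ‖x‖ • x) := by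
  rw [(hasFDerivAt_comp_norm hφ (by simp) x).fderiv, map_smul]
  rcases eq_or_ne x 0 with rfl | hx
  · simp
  · rw [mul_div_cancel_left₀ _ (norm_ne_zero_iff.2 hx)]

theorem contDiff_three_comp_norm (hφ : ∀ r, HasDerivAt φ (r * p r) r)
    (h : RadialField p p' q q') :
    ContDiff ℝ 3 (fun x : EuclideanSpace ℝ (Fin n) => φ ‖x‖) := by
  rw [show (3 : WithTop ℕ∞) = 2 + 1 by norm_num, contDiff_succ_iff_fderiv]
  refine ⟨fun x => (hasFDerivAt_comp_norm hφ (by simp) x).differentiableAt, by simp, ?_⟩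
  rw [funext (fderiv_comp_norm_eq hφ)]
  exact (innerSL ℝ).contDiff.comp h.contDiff_two

theorem lap_comp_norm (hφ : ∀ r, HasDerivAt φ (r * p r) r) (h : RadialField p p' q q')
    (x : EuclideanSpace ℝ (Fin n)) : lap (fun x => φ ‖x‖) x = n * p ‖x‖ + q ‖x‖ := by
  rw [← h.sum_pd_coord, lap]
  refine Finset.sum_congr rfl fun i _ => ?_
  congr 1
  funext z
  rw [pd, fderiv_comp_norm_eq hφ]
  simp [EuclideanSpace.inner_single_right]

theorem norm_iteratedFDeriv_two_comp_norm_le (hφ : ∀ r, HasDerivAt φ (r * p r) r)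
    (h : RadialField p p' q q') (x : EuclideanSpace ℝ (Fin n)) :
    ‖iteratedFDeriv ℝ 2 (fun x : EuclideanSpace ℝ (Fin n) => φ ‖x‖) x‖ ≤ |p ‖x‖| + |q ‖x‖| := by
  rw [show 2 = 1 + 1 by norm_num, ← norm_iteratedFDeriv_fderiv, ← zero_add 1,
    ← norm_iteratedFDeriv_fderiv, norm_iteratedFDeriv_zero, funext (fderiv_comp_norm_eq hφ)]
  have h1 : HasFDerivAt (fun x : EuclideanSpace ℝ (Fin n) => innerSL ℝ (p ‖x‖ • x)) _ x :=
    (innerSL ℝ).hasFDerivAt.comp x (h.hasFDerivAt x)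
  rw [h1.fderiv]
  refine le_trans ?_ (RadialField.norm_radialFieldDeriv_le p q x)
  refine (ContinuousLinearMap.opNorm_comp_le _ _).trans ?_
  exact mul_le_of_le_one_left (norm_nonneg _) (norm_innerSL_le ℝ)

end Coordinates

/-- The restriction of a radial `C¹` function to a line through the origin. -/
theorem exists_decayProfile {d : ℕ} {β C : ℝ} (hβ : 1 < β) (hβd : β ≤ d) (hC : 0 < C)
    {τ : EuclideanSpace ℝ (Fin (d + 1)) → ℝ} {τ₀ : ℝ → ℝ} (hτrad : ∀ x, τ x = τ₀ ‖x‖)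
    (hτreg : ContDiff ℝ 1 τ) (hτ0 : ∀ x, |τ x| ≤ C * (1 + ‖x‖) ^ (-β))
    (hτ1 : ∀ x, ‖fderiv ℝ τ x‖ ≤ C * (1 + ‖x‖) ^ (-β - 1)) :
    ∃ σ σ' : ℝ → ℝ, DecayProfile d β C σ σ' ∧ (∀ s, σ (-s) = σ s) ∧ ∀ x, τ x = σ ‖x‖ := by
  set e : EuclideanSpace ℝ (Fin (d + 1)) := EuclideanSpace.single 0 1 with he
  have hnorm : ∀ t : ℝ, ‖t • e‖ = |t| := fun t => by simp [he, norm_smul]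
  refine ⟨fun t => τ (t • e), fun t => fderiv ℝ τ (t • e) e,
    ⟨fun s => ?_, ?_, fun s => ?_, fun s => ?_, hβ, hβd, hC⟩, fun s => ?_, fun x => ?_⟩
  · have h1 : HasDerivAt (fun t : ℝ => t • e) e s := by
      simpa using (hasDerivAt_id s).smul_const e
    exact ((hτreg.differentiable (by norm_num)) (s • e)).hasFDerivAt.comp_hasDerivAt s h1
  · exact ((hτreg.continuous_fderiv (by norm_num)).comp (by fun_prop)).clm_apply continuous_const
  · simpa [hnorm] using hτ0 (s • e)
  · have h1 := (fderiv ℝ τ (s • e)).le_opNorm e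
    rw [show ‖e‖ = 1 by simp [he], mul_one, Real.norm_eq_abs] at h1
    simpa [hnorm] using h1.trans (hτ1 (s • e))
  · simp only [hτrad, hnorm, abs_neg]
  · simp only [hτrad, hnorm, abs_norm]

namespace RadialSolution

variable {d : ℕ} {β B : ℝ} {τ τ' μ k k' f f' y' : ℝ → ℝ}

theorem solvesCCE (h : RadialSolution d β B τ μ k k') (hd : 2 ≤ d)
    (hτ : ∀ r, HasDerivAt τ (τ' r) r) (hτc : Continuous τ') (hτ0 : τ' 0 = 0)
    (hf : RadialField f f' (shearProfile d τ μ k) y')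
    (hfy : ∀ r, (d + 1) * f' r + y' r = 1 / 2 * (Real.exp (-(((d : ℝ) + 1) * μ r)) * τ' r)) :
    SolvesCCE (d + 1) (fun x => Real.exp (-(((d : ℝ) - 1) / 2 * μ ‖x‖))) (fun x => τ ‖x‖)
      (fun j x => f ‖x‖ * x j) := by
  have hd1 : (d : ℝ) - 1 ≠ 0 := by
    have : (2 : ℝ) ≤ d := by exact_mod_cast hd
    linarith
  have hd2 : (d : ℝ) + 1 ≠ 0 := by positivity
  have hd3 : (d : ℝ) + 1 - 2 ≠ 0 := by convert hd1 using 1; ring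
  obtain ⟨p', q', hp⟩ := h.exists_radialField_grad hτ hτc hτ0
  constructor
  · intro x
    rw [lap_comp_norm (φ := fun r => Real.exp (-(((d : ℝ) - 1) / 2 * μ r)))
      h.hasDerivAt_conformalFactor hp, hf.sum_sq_cK_coord x (by exact_mod_cast hd2), ← Real.exp_mul,
      ← Real.exp_mul]
    simp only [Nc, Nat.cast_add, Nat.cast_one]
    have e1 : -(((d : ℝ) - 1) / 2 * μ ‖x‖) * (2 * (d + 1) / (d + 1 - 2) - 1) =
        -((d + 3) / 2 * μ ‖x‖) := by
      field_simp
      ring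
    have e2 : -(((d : ℝ) - 1) / 2 * μ ‖x‖) * (-(2 * (d + 1) / (d + 1 - 2)) - 1) =
        -((d + 3) / 2 * μ ‖x‖) + ((d + 1) * μ ‖x‖ + (d + 1) * μ ‖x‖) := by
      field_simp
      ring
    have e3 : Real.exp (-((d + 1) * μ ‖x‖)) * Real.exp ((d + 1) * μ ‖x‖) = 1 := by
      rw [← Real.exp_add]
      simp
    rw [e1, e2, Real.exp_add _ (_ + _), Real.exp_add ((d + 1) * μ ‖x‖), lapProfile, shearProfile]
    set X := Real.exp (-((d + 3) / 2 * μ ‖x‖))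
    set Y := Real.exp (-((d + 1) * μ ‖x‖))
    set Z := Real.exp ((d + 1) * μ ‖x‖)
    have e4 : 4 * ((d : ℝ) + 1 - 1) / (d + 1) * (1 / 2 * (Y * (τ ‖x‖ - (d + 1) * k ‖x‖))) ^ 2 *
        (X * (Z * Z)) = d / (d + 1) * (τ ‖x‖ - (d + 1) * k ‖x‖) ^ 2 * X * (Y * Z) ^ 2 := by
      ring
    rw [e4, e3]
    rw [show (d : ℝ) + 1 - 2 = d - 1 by ring]
    field_simp
    ring
  · intro i x
    rw [hf.lap_coord, hf.pd_sum_pd_coord, pd_comp_norm hτ hτ0, ← Real.exp_mul]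
    simp only [Nc, Nat.cast_add, Nat.cast_one]
    have e1 : -(((d : ℝ) - 1) / 2 * μ ‖x‖) * (2 * (d + 1) / (d + 1 - 2)) =
        -((d + 1) * μ ‖x‖) := by
      rw [show (d : ℝ) + 1 - 2 = d - 1 by ring]
      field_simp
    rw [e1, hfy]
    field_simp
    ring

theorem abs_kTen_le (h : RadialSolution d β B τ μ k k') (hd : 2 ≤ d) (hβ : 1 < β) {C : ℝ}
    (hτ : ∀ s, |τ s| ≤ C * (1 + |s|) ^ (-β)) (hf : RadialField f f' (shearProfile d τ μ k) y')
    (i j : Fin (d + 1)) (x : EuclideanSpace ℝ (Fin (d + 1))) :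
    |kTen (d + 1) (fun x => Real.exp (-(((d : ℝ) - 1) / 2 * μ ‖x‖))) (fun x => τ ‖x‖)
      (fun j x => f ‖x‖ * x j) i j x| ≤
      (C + Real.exp ((d - 1) * B) * (4 * (C + (d + 1) * B))) * (1 + ‖x‖) ^ (-β) := by
  have hd1 : (1 : ℝ) ≤ d - 1 := by
    have : (2 : ℝ) ≤ d := by exact_mod_cast hd
    linarith
  set w := (1 + ‖x‖) ^ (-β) with hw
  have hw0 : 0 < w := by positivity
  have h1 : |τ ‖x‖| ≤ C * w := by simpa using hτ ‖x‖
  have h2 : |shearProfile d τ μ k ‖x‖| ≤ (C + (d + 1) * B) * w := by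
    simpa using h.abs_shearProfile_le hτ ‖x‖
  have h3 := hf.abs_cK_coord_le i j x (by push_cast; linarith)
  have h4 : μ ‖x‖ ≤ B := by
    refine (h.mu_le _).trans (mul_le_of_le_one_right h.bound_pos.le ?_)
    exact Real.rpow_le_one_of_one_le_of_nonpos (by simp) (by linarith)
  have h5 : Real.exp (-(((d : ℝ) - 1) / 2 * μ ‖x‖)) ^ (-2 : ℝ) ≤ Real.exp ((d - 1) * B) := by
    rw [← Real.exp_mul, Real.exp_le_exp,
      show -(((d : ℝ) - 1) / 2 * μ ‖x‖) * -2 = (d - 1) * μ ‖x‖ by ring]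
    exact mul_le_mul_of_nonneg_left h4 (by linarith)
  have h6 : Real.exp (-(((d : ℝ) - 1) / 2 * μ ‖x‖)) ^ (Nc (d + 1) - 2) ≤ 1 := by
    refine Real.rpow_le_one (by positivity) (h.exp_neg_mul_mu_le_one (by linarith) _) ?_
    rw [Nc, sub_nonneg, le_div_iff₀ (by push_cast; linarith)]
    push_cast
    linarith
  have h7 : |τ ‖x‖ / ((d + 1 : ℕ) : ℝ)| ≤ C * w := by
    rw [abs_div, Nat.abs_cast]
    exact (div_le_self (abs_nonneg _) (by push_cast; linarith)).trans h1
  have h8 : |(if i = j then (1 : ℝ) else 0)| ≤ 1 := by split_ifs <;> simp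
  rw [kTen]
  refine (abs_add_le _ _).trans ?_
  rw [abs_mul, abs_mul, abs_mul, abs_of_nonneg (Real.rpow_nonneg (Real.exp_nonneg _) _),
    abs_of_nonneg (Real.rpow_nonneg (Real.exp_nonneg _) _), add_mul]
  refine add_le_add ?_ ?_
  · refine (mul_le_of_le_one_right (by positivity) h8).trans ?_
    exact (mul_le_of_le_one_right (abs_nonneg _) h6).trans h7
  · rw [mul_assoc]
    refine mul_le_mul h5 (h3.trans ?_) (abs_nonneg _) (Real.exp_nonneg _)
    linarith

theorem norm_fderiv_conformalFactor_le (h : RadialSolution d β B τ μ k k') (hd : 1 ≤ d)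
    (x : EuclideanSpace ℝ (Fin (d + 1))) :
    ‖fderiv ℝ (fun x : EuclideanSpace ℝ (Fin (d + 1)) =>
      Real.exp (-(((d : ℝ) - 1) / 2 * μ ‖x‖))) x‖ ≤ d * B ^ 2 * (1 + ‖x‖) ^ (1 - 2 * β) := by
  have h0 : 0 < 1 + ‖x‖ := by positivity
  have h1 : |gradProfile d μ k ‖x‖| ≤ d * B ^ 2 * (1 + ‖x‖) ^ (-(2 * β)) := by
    simpa using h.abs_gradProfile_le hd ‖x‖
  rw [fderiv_comp_norm_eq (φ := fun r => Real.exp (-(((d : ℝ) - 1) / 2 * μ r)))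
    h.hasDerivAt_conformalFactor, innerSL_apply_norm, norm_smul, Real.norm_eq_abs,
    show 1 - 2 * β = -(2 * β) + 1 by ring, Real.rpow_add h0, Real.rpow_one, ← mul_assoc]
  exact mul_le_mul h1 (by linarith) (norm_nonneg _) (by positivity)

theorem norm_iteratedFDeriv_two_conformalFactor_le (h : RadialSolution d β B τ μ k k')
    (hd : 1 ≤ d) {C : ℝ} (hτb : ∀ s, |τ s| ≤ C * (1 + |s|) ^ (-β))
    (hτ : ∀ r, HasDerivAt τ (τ' r) r) (hτc : Continuous τ') (hτ0 : τ' 0 = 0)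
    (x : EuclideanSpace ℝ (Fin (d + 1))) :
    ‖iteratedFDeriv ℝ 2 (fun x : EuclideanSpace ℝ (Fin (d + 1)) =>
      Real.exp (-(((d : ℝ) - 1) / 2 * μ ‖x‖))) x‖ ≤
      ((d + 2) * (d * B ^ 2) + d * (B * C + (d + 1) * B ^ 2)) * (1 + ‖x‖) ^ (-(2 * β)) := by
  obtain ⟨p', q', hp⟩ := h.exists_radialField_grad hτ hτc hτ0
  have h1 : |gradProfile d μ k ‖x‖| ≤ d * B ^ 2 * (1 + ‖x‖) ^ (-(2 * β)) := by
    simpa using h.abs_gradProfile_le hd ‖x‖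
  have h2 : |lapProfile d τ μ k ‖x‖| ≤
      d * (B * C + (d + 1) * B ^ 2) * (1 + ‖x‖) ^ (-(2 * β)) := by
    simpa using h.abs_lapProfile_le hd hτb ‖x‖
  refine (norm_iteratedFDeriv_two_comp_norm_le
    (φ := fun r => Real.exp (-(((d : ℝ) - 1) / 2 * μ r))) h.hasDerivAt_conformalFactor
    hp x).trans ?_
  have h3 := abs_sub (lapProfile d τ μ k ‖x‖) ((d + 1) * gradProfile d μ k ‖x‖)
  rw [abs_mul, abs_of_nonneg (by positivity : (0 : ℝ) ≤ d + 1)] at h3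
  have h4 := mul_le_mul_of_nonneg_left h1 (by positivity : (0 : ℝ) ≤ d + 2)
  linarith

end RadialSolution

/-- Freely specified mean curvature: for any radial `C¹`
function `τ` with decay rate `β ∈ (1, n/2)`, there is a radial, positive,
nondecreasing `C³` conformal factor `φ` and a `C²` vector field `W` such that
`(φ, τ, W)` solves the vacuum conformal constraint equations; consequently
`g = φ^{N−2}δ`, `k` solve the vacuum constraint equations with `tr_g k = τ`,
`|g_{ij} − δ_{ij}| ≤ C''(1+|x|)^{2−2β}` and `|k_{ij}| ≤ C''(1+|x|)^{−β}`. -/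
theorem stmt10 (n : ℕ) (hn : 3 ≤ n) (α β C : ℝ) (hα : α ∈ Set.Ioo (0 : ℝ) 1)
    (hβ : 1 < β) (hβ' : β < (n : ℝ) / 2) (hC : 0 < C)
    (τ : EuclideanSpace ℝ (Fin n) → ℝ) (τ₀ : ℝ → ℝ)
    (hτrad : ∀ x, τ x = τ₀ ‖x‖)
    (hτreg : ContDiff ℝ 1 τ)
    (hτ0 : ∀ x, |τ x| ≤ C * (1 + ‖x‖) ^ (-β))
    (hτ1 : ∀ x, ‖fderiv ℝ τ x‖ ≤ C * (1 + ‖x‖) ^ (-β - 1)) :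
    ∃ (φ : EuclideanSpace ℝ (Fin n) → ℝ) (φ₀ : ℝ → ℝ)
      (W : Fin n → EuclideanSpace ℝ (Fin n) → ℝ),
      (∀ x, φ x = φ₀ ‖x‖) ∧ (∀ x, 0 < φ x) ∧
      MonotoneOn φ₀ (Set.Ici (0 : ℝ)) ∧
      ContDiff ℝ 3 φ ∧
      (∃ C' > 0, ∀ x,
        |φ x - 1| ≤ C' * (1 + ‖x‖) ^ (2 - 2 * β) ∧
        ‖fderiv ℝ φ x‖ ≤ C' * (1 + ‖x‖) ^ (1 - 2 * β) ∧
        ‖iteratedFDeriv ℝ 2 φ x‖ ≤ C' * (1 + ‖x‖) ^ (-(2 * β))) ∧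
      (∀ i, ContDiff ℝ 2 (W i)) ∧
      SolvesCCE n φ τ W ∧
      -- decay of the induced initial data (g, k)
      (∃ C'' > 0, ∀ x,
        |(φ x) ^ (Nc n - 2) - 1| ≤ C'' * (1 + ‖x‖) ^ (2 - 2 * β) ∧
        ∀ i j, |kTen n φ τ W i j x| ≤ C'' * (1 + ‖x‖) ^ (-β)) := by
  obtain ⟨d, rfl⟩ : ∃ d, n = d + 1 := ⟨n - 1, by omega⟩
  have hd : 2 ≤ d := by omega
  have hdR : (2 : ℝ) ≤ d := by exact_mod_cast hd
  push_cast at hβ'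
  obtain ⟨σ, σ', hσ, hσe, hσn⟩ :=
    exists_decayProfile hβ (by linarith) hC hτrad hτreg hτ0 hτ1
  obtain rfl : τ = fun x => σ ‖x‖ := funext hσn
  have hσ0 : σ' 0 = 0 := deriv_zero_of_even hσ.hasDerivAt hσe
  obtain ⟨B, μ, k, k', h⟩ := hσ.exists_radialSolution hσe
  obtain ⟨f, f', y', hf, hfy⟩ := h.exists_radialField_shear hσ.hasDerivAt hσ.continuous_deriv hσ0
  obtain ⟨p', q', hp⟩ := h.exists_radialField_grad hσ.hasDerivAt hσ.continuous_deriv hσ0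
  have hB := h.bound_pos
  have hc : 0 ≤ ((d : ℝ) - 1) / 2 := by linarith
  set K := (d + 2) * (d * B ^ 2) + d * (B * C + (d + 1) * B ^ 2) with hK
  refine ⟨fun x => Real.exp (-(((d : ℝ) - 1) / 2 * μ ‖x‖)),
    fun r => Real.exp (-(((d : ℝ) - 1) / 2 * μ r)), fun j x => f ‖x‖ * x j, fun x => rfl,
    fun x => Real.exp_pos _, h.monotoneOn_conformalFactor (by omega),
    contDiff_three_comp_norm (φ := fun r => Real.exp (-(((d : ℝ) - 1) / 2 * μ r)))
      h.hasDerivAt_conformalFactor hp,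
    ⟨((d : ℝ) - 1) / 2 * B + K, by positivity, fun x => ⟨?_, ?_, ?_⟩⟩, hf.contDiff_coord,
    h.solvesCCE hd hσ.hasDerivAt hσ.continuous_deriv hσ0 hf hfy,
    ⟨2 * B + (C + Real.exp ((d - 1) * B) * (4 * (C + (d + 1) * B))), by positivity,
      fun x => ⟨?_, fun i j => ?_⟩⟩⟩
  · have h1 := h.abs_exp_neg_mul_mu_sub_one_le hc ‖x‖
    rw [abs_norm] at h1
    refine h1.trans ?_
    gcongr
    exact le_add_of_nonneg_right (by positivity)
  · refine (h.norm_fderiv_conformalFactor_le (by omega) x).trans ?_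
    gcongr
    have h1 : 0 ≤ ((d : ℝ) + 1) * (d * B ^ 2) + d * (B * C + (d + 1) * B ^ 2) := by positivity
    have h2 : 0 ≤ ((d : ℝ) - 1) / 2 * B := by positivity
    linarith
  · refine (h.norm_iteratedFDeriv_two_conformalFactor_le (by omega) hσ.abs_le hσ.hasDerivAt
      hσ.continuous_deriv hσ0 x).trans ?_
    refine mul_le_mul_of_nonneg_right ?_ (by positivity)
    exact le_add_of_nonneg_left (by positivity)
  · have h1 := h.abs_exp_neg_mul_mu_sub_one_le zero_le_two ‖x‖
    have h2 : Real.exp (-(((d : ℝ) - 1) / 2 * μ ‖x‖)) ^ (Nc (d + 1) - 2) =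
        Real.exp (-(2 * μ ‖x‖)) := by
      have hd1 : (d : ℝ) - 1 ≠ 0 := by linarith
      rw [← Real.exp_mul, Nc]
      push_cast
      rw [show (d : ℝ) + 1 - 2 = d - 1 by ring]
      congr 1
      field_simp
      ring
    rw [abs_norm] at h1
    rw [h2]
    refine h1.trans ?_
    gcongr
    exact le_add_of_nonneg_right (by positivity)
  · refine (h.abs_kTen_le hd hβ hσ.abs_le hf i j x).trans ?_
    refine mul_le_mul_of_nonneg_right ?_ (by positivity)
    exact le_add_of_nonneg_left (by positivity)
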